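/- Let θ be the defining sequence for a generalized Ewens measure. Suppose g_θ is log-admissible and r_x (the unique solution of a(r) = x) satisfies the technical condition (*). Then there are sequences μ_n and σ_n with μ_n = g_θ(r_n)(1 + o(1)) and σ_n² = (g_θ(r_n) + n η_1(n))(1 + o(1)) such that (K_{0n} − μ_n)/σ_n converges in distribution to a standard normal random variable as n → ∞. -/

import Mathlib

open Filter Set Asymptotics MeasureTheory
open scoped Topology

noncomputable section

/-- `c_j(σ)`: the number of cycles of length `j` in the permutation `σ ∈ S_n`
(fixed points count as cycles of length 1). -/
def cycleCount (n j : ℕ) (σ : Equiv.Perm (Fin n)) : ℕ :=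
  if j = 1 then n - σ.support.card else σ.cycleType.count j

/-- `K_{0n}(σ) = Σ_{j=1}^n c_j(σ)`: the total number of cycles of `σ`. -/
def numCycles (n : ℕ) (σ : Equiv.Perm (Fin n)) : ℕ :=
  (n - σ.support.card) + σ.cycleType.card

/-- The unnormalized generalized Ewens weight `∏_{j=1}^n θ_j^{c_j(σ)}`. -/
def ewensWeight (θ : ℕ → ℝ) (n : ℕ) (σ : Equiv.Perm (Fin n)) : ℝ :=
  ∏ j ∈ Finset.Icc 1 n, θ j ^ cycleCount n j σ

/-- The normalization constant `h_n = (1/n!) Σ_σ ∏_j θ_j^{c_j(σ)}` of the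
generalized Ewens measure (equivalently, the `n`-th coefficient of `exp g_θ`). -/
def ewensH (θ : ℕ → ℝ) (n : ℕ) : ℝ :=
  (n.factorial : ℝ)⁻¹ * ∑ σ : Equiv.Perm (Fin n), ewensWeight θ n σ

open scoped Classical in
/-- Probability of an event under the generalized Ewens measure
`ℙ(σ) = (1/(h_n n!)) ∏_j θ_j^{c_j(σ)}`. -/
def ewensProb (θ : ℕ → ℝ) (n : ℕ) (p : Equiv.Perm (Fin n) → Prop) : ℝ :=
  (∑ σ ∈ Finset.univ.filter p, ewensWeight θ n σ) /
    ∑ σ : Equiv.Perm (Fin n), ewensWeight θ n σ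

/-- Expectation under the generalized Ewens measure. -/
def ewensExpect (θ : ℕ → ℝ) (n : ℕ) (f : Equiv.Perm (Fin n) → ℝ) : ℝ :=
  (∑ σ : Equiv.Perm (Fin n), f σ * ewensWeight θ n σ) /
    ∑ σ : Equiv.Perm (Fin n), ewensWeight θ n σ

/-- The coefficient sequence of `g_θ(t) = Σ_{k≥1} (θ_k/k) t^k`. -/
def thetaCoeff (θ : ℕ → ℝ) : ℕ → ℝ := fun k => if k = 0 then 0 else θ k / k

/-- `g_θ` as a function on the complex disc. -/
def gThetaC (θ : ℕ → ℝ) : ℂ → ℂ := fun z => ∑' k : ℕ, (thetaCoeff θ k : ℂ) * z ^ k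

/-- `g_θ` as a real function. -/
def gThetaR (θ : ℕ → ℝ) : ℝ → ℝ := fun t => ∑' k : ℕ, thetaCoeff θ k * t ^ k

/-- The standard normal cumulative distribution function. -/
def stdNormalCDF (x : ℝ) : ℝ :=
  ∫ t in Set.Iic x, Real.exp (-t ^ 2 / 2) / Real.sqrt (2 * Real.pi)

/-- `(K_{0n} - μ_n)/σ_n` converges in distribution to a standard normal random
variable, where `K_{0n}` is distributed according to the generalized Ewens
measure with weights `θ` (stated via pointwise convergence of the CDFs to the
continuous standard normal CDF). -/
def convergesToStdNormal (θ : ℕ → ℝ) (μ σ' : ℕ → ℝ) : Prop :=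
  ∀ x : ℝ, Tendsto
    (fun n => ewensProb θ n fun σ => ((numCycles n σ : ℝ) - μ n) / σ' n ≤ x)
    atTop (𝓝 (stdNormalCDF x))

/-- `log`-admissibility of a power series `g` with coefficients `gc`, radius of
convergence `ρ`, and associated functions `a`, `b`, `δ` (Definition 2.1). -/
structure IsLogAdmissible (g : ℂ → ℂ) (gc : ℕ → ℝ) (ρ : ℝ) (a b δ : ℝ → ℝ) : Prop where
  rho_pos : 0 < ρ
  coeff_nonneg : ∀ n, 0 ≤ gc n
  series : ∀ z : ℂ, ‖z‖ < ρ → HasSum (fun n => (gc n : ℂ) * z ^ n) (g z)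
  radius : ∀ t : ℝ, ρ < t → ¬ Summable fun n => gc n * t ^ n
  a_nonneg : ∀ r ∈ Set.Ico (0 : ℝ) ρ, 0 ≤ a r
  b_nonneg : ∀ r ∈ Set.Ico (0 : ℝ) ρ, 0 ≤ b r
  delta_pos : ∀ r ∈ Set.Ico (0 : ℝ) ρ, 0 < δ r
  /-- approximation: `g(re^{iφ}) = g(r) + iφa(r) - φ²b(r)/2 + R(r,φ)` with
  `R(r,φ) = o(φ³ δ(r)⁻³)` uniformly in `φ` as `r → ρ`. -/
  approx : ∃ ε : ℝ → ℝ, Tendsto ε (𝓝[<] ρ) (𝓝 0) ∧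
    ∀ r ∈ Set.Ico (0 : ℝ) ρ, ∀ φ : ℝ, |φ| ≤ δ r →
      ‖g (r * Complex.exp (φ * Complex.I)) -
          (g r + φ * Complex.I * a r - (φ : ℂ) ^ 2 / 2 * b r)‖ ≤
        ε r * |φ| ^ 3 * (δ r)⁻¹ ^ 3
  a_div : Tendsto a (𝓝[<] ρ) atTop
  b_div : Tendsto b (𝓝[<] ρ) atTop
  delta_lim : Tendsto δ (𝓝[<] ρ) (𝓝 0)
  width : ∀ ε : ℝ, 0 < ε →
    Tendsto (fun r => ε * δ r ^ 2 * b r - Real.log (b r)) (𝓝[<] ρ) atTop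
  mono : ∀ r ∈ Set.Ico (0 : ℝ) ρ, ∀ φ : ℝ, δ r < |φ| → |φ| ≤ Real.pi →
    (g (r * Complex.exp (φ * Complex.I))).re ≤
      max (g (r * Complex.exp (δ r * Complex.I))).re
        (g (r * Complex.exp (-δ r * Complex.I))).re

/-- The technical condition (*): `|r_x^{(k)}| x^k ≲ |r_x^{(k-1)}| x^{k-1}` for
all sufficiently large `x` and `2 ≤ k ≤ 4`. -/
def TechCond (r : ℝ → ℝ) : Prop :=
  ∃ C > 0, ∃ x₀ : ℝ, ∀ x ≥ x₀, ∀ k : ℕ, 2 ≤ k → k ≤ 4 →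
    |iteratedDeriv k r x| * x ^ k ≤ C * |iteratedDeriv (k - 1) r x| * x ^ (k - 1)

/-- The cycle-index weight `∏_{j ≤ N} y_j ^ {c_j} / c_j!` of a multiset of cycle lengths. -/
def cycleIndexWeight (y : ℕ → ℂ) (N : ℕ) (s : Multiset ℕ) : ℂ :=
  ∏ j ∈ Finset.Icc 1 N, y j ^ s.count j / ((s.count j).factorial : ℂ)

/-- The sum of the cycle-index weights over all partitions of `n`. -/
def cycleIndexSum (y : ℕ → ℂ) (N n : ℕ) : ℂ :=
  ∑ p : n.Partition, cycleIndexWeight y N p.parts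

lemma cycleIndexWeight_cons (y : ℕ → ℂ) {N j : ℕ} (hj : j ∈ Finset.Icc 1 N) (s : Multiset ℕ) :
    ((s.count j : ℂ) + 1) * cycleIndexWeight y N (j ::ₘ s) = y j * cycleIndexWeight y N s := by
  unfold cycleIndexWeight
  rw [← Finset.mul_prod_erase _ _ hj, ← Finset.mul_prod_erase _ _ hj]
  have h : ∀ i ∈ (Finset.Icc 1 N).erase j, (j ::ₘ s).count i = s.count i := by
    intro i hi
    rw [Multiset.count_cons_of_ne (Finset.ne_of_mem_erase hi)]
  rw [Finset.prod_congr rfl fun i hi => by rw [h i hi]]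
  rw [Multiset.count_cons_self, Nat.factorial_succ, pow_succ]
  have h1 : ((s.count j : ℂ) + 1) ≠ 0 := Nat.cast_add_one_ne_zero _
  have h2 : ((s.count j).factorial : ℂ) ≠ 0 := Nat.cast_ne_zero.2 (Nat.factorial_ne_zero _)
  push_cast
  field_simp

lemma sum_count_mul_cycleIndexWeight (y : ℕ → ℂ) {N n j : ℕ} (hn : n ≤ N)
    (hj : j ∈ Finset.Icc 1 n) :
    ∑ p : n.Partition, (p.parts.count j : ℂ) * cycleIndexWeight y N p.parts =
      y j * cycleIndexSum y N (n - j) := by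
  classical
  obtain ⟨h1, h2⟩ := Finset.mem_Icc.1 hj
  have hjN : j ∈ Finset.Icc 1 N := Finset.mem_Icc.2 ⟨h1, h2.trans hn⟩
  rw [cycleIndexSum, Finset.mul_sum,
    ← Finset.sum_filter_add_sum_filter_not Finset.univ (fun p : n.Partition => j ∈ p.parts),
    Finset.sum_eq_zero (s := Finset.univ.filter fun p : n.Partition => ¬ j ∈ p.parts), add_zero]
  · rw [← Finset.sum_subtype_eq_sum_filter, Finset.subtype_univ,
      ← (Nat.Partition.partitionWithPartEquiv h1 h2).symm.sum_comp]
    refine Finset.sum_congr rfl fun q _ => ?_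
    rw [Nat.Partition.partitionWithPartEquiv_symm_apply_parts, ← cycleIndexWeight_cons y hjN,
      Multiset.count_cons_self]
    push_cast
    rfl
  · intro p hp
    rw [Multiset.count_eq_zero_of_notMem (Finset.mem_filter.1 hp).2]
    simp

lemma nat_mul_cycleIndexSum (y : ℕ → ℂ) {N n : ℕ} (hn : n ≤ N) :
    (n : ℂ) * cycleIndexSum y N n =
      ∑ j ∈ Finset.Icc 1 n, (j : ℂ) * y j * cycleIndexSum y N (n - j) := by
  have h : ∀ p : n.Partition, (n : ℂ) = ∑ j ∈ Finset.Icc 1 n, (j : ℂ) * (p.parts.count j : ℂ) := by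
    intro p
    have h1 : p.parts.sum = ∑ j ∈ Finset.Icc 1 n, p.parts.count j * j := by
      conv_lhs => rw [Finset.sum_multiset_count]
      refine Finset.sum_subset (fun i hi => ?_) fun i _ hi => ?_
      · have hi' := Multiset.mem_toFinset.1 hi
        exact Finset.mem_Icc.2 ⟨p.parts_pos hi', p.le_of_mem_parts hi'⟩
      · rw [Multiset.count_eq_zero_of_notMem (fun h => hi (Multiset.mem_toFinset.2 h))]
        simp
    rw [p.parts_sum] at h1
    conv_lhs => rw [h1]
    push_cast
    exact Finset.sum_congr rfl fun _ _ => mul_comm _ _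
  calc (n : ℂ) * cycleIndexSum y N n
      = ∑ p : n.Partition, ∑ j ∈ Finset.Icc 1 n,
          (j : ℂ) * ((p.parts.count j : ℂ) * cycleIndexWeight y N p.parts) := by
        rw [cycleIndexSum, Finset.mul_sum]
        refine Finset.sum_congr rfl fun p _ => ?_
        conv_lhs => rw [h p]
        rw [Finset.sum_mul]
        exact Finset.sum_congr rfl fun _ _ => mul_assoc _ _ _
    _ = _ := by
        rw [Finset.sum_comm]
        refine Finset.sum_congr rfl fun j hj => ?_
        rw [← Finset.mul_sum, sum_count_mul_cycleIndexWeight y hn hj, mul_assoc]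

lemma cycleIndexSum_zero (y : ℕ → ℂ) (N : ℕ) : cycleIndexSum y N 0 = 1 := by
  simp [cycleIndexSum, cycleIndexWeight]

lemma card_partition_eq_mul {α : Type*} [Fintype α] [DecidableEq α]
    (p : (Fintype.card α).Partition) :
    (Finset.univ.filter fun σ : Equiv.Perm α => σ.partition = p).card *
      ∏ j ∈ Finset.Icc 1 (Fintype.card α),
        (j ^ p.parts.count j * (p.parts.count j).factorial) = (Fintype.card α).factorial := by
  classical
  set m := p.parts.filter (2 ≤ ·) with hm
  have hparts : p.parts = m + Multiset.replicate (p.parts.count 1) 1 := by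
    conv_lhs => rw [← Multiset.filter_add_not (fun i => 2 ≤ i) p.parts]
    congr 1
    rw [← Multiset.filter_eq']
    refine Multiset.filter_congr ?_
    intro x hx
    have := p.parts_pos hx
    omega
  have hsum : m.sum + p.parts.count 1 = Fintype.card α := by
    have := congrArg Multiset.sum hparts
    simpa [p.parts_sum] using this.symm
  have hcard : (Finset.univ.filter fun σ : Equiv.Perm α => σ.partition = p) =
      Finset.univ.filter fun σ : Equiv.Perm α => σ.cycleType = m := by
    ext σ
    simp only [Finset.mem_filter, Finset.mem_univ, true_and]
    constructor
    · rintro rfl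
      exact σ.filter_parts_partition_eq_cycleType.symm
    · intro h
      ext1
      rw [Equiv.Perm.parts_partition, h, hparts]
      congr 2
      rw [← Equiv.Perm.sum_cycleType, h]
      omega
  have key := Equiv.Perm.card_of_cycleType_mul_eq α m
  rw [if_pos ⟨by omega, fun a ha => (Multiset.mem_filter.1 ha).2⟩] at key
  rw [hcard, ← key]
  congr 1
  rw [Finset.prod_mul_distrib]
  have hsub : m.toFinset ⊆ Finset.Icc 1 (Fintype.card α) := by
    intro i hi
    have hi' := (Multiset.mem_filter.1 (Multiset.mem_toFinset.1 hi)).1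
    exact Finset.mem_Icc.2 ⟨p.parts_pos hi', p.le_of_mem_parts hi'⟩
  have hcount : ∀ j, j ∈ m.toFinset → m.count j = p.parts.count j := by
    intro j hj
    exact Multiset.count_filter_of_pos (Multiset.mem_filter.1 (Multiset.mem_toFinset.1 hj)).2
  have hcount' : ∀ j ∈ Finset.Icc 1 (Fintype.card α), j ∉ m.toFinset → j ≠ 1 →
      p.parts.count j = 0 := by
    intro j hj hjm hj1
    refine Multiset.count_eq_zero_of_notMem fun h => hjm ?_
    exact Multiset.mem_toFinset.2 (Multiset.mem_filter.2 ⟨h, by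
      have := (Finset.mem_Icc.1 hj).1; omega⟩)
  have h1 : ∏ j ∈ Finset.Icc 1 (Fintype.card α), j ^ p.parts.count j = m.prod := by
    rw [Finset.prod_multiset_count, ← Finset.prod_subset hsub]
    · exact Finset.prod_congr rfl fun j hj => by rw [hcount j hj]
    · intro j hj hjm
      by_cases hj1 : j = 1
      · simp [hj1]
      · simp [hcount' j hj hjm hj1]
  have h1m : 1 ∉ m.toFinset := by simp [hm]
  have h2 : ∏ j ∈ Finset.Icc 1 (Fintype.card α), (p.parts.count j).factorial =
      (Fintype.card α - m.sum).factorial * ∏ j ∈ m.toFinset, (m.count j).factorial := by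
    have hc1 : Fintype.card α - m.sum = p.parts.count 1 := by omega
    rw [hc1]
    rw [show ∏ j ∈ m.toFinset, (m.count j).factorial =
      ∏ j ∈ m.toFinset, (p.parts.count j).factorial from
        Finset.prod_congr rfl fun j hj => by rw [hcount j hj],
      ← Finset.prod_insert (f := fun j => (p.parts.count j).factorial) h1m]
    by_cases hn : 1 ≤ Fintype.card α
    · symm
      refine Finset.prod_subset (Finset.insert_subset (by simpa using hn) hsub) ?_
      intro j hj hjm
      rw [Finset.mem_insert, not_or] at hjm
      simp [hcount' j hj hjm.2 hjm.1]
    · have h0 : p.parts.count 1 = 0 := by omega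
      have : Finset.Icc 1 (Fintype.card α) = ∅ := Finset.Icc_eq_empty (by omega)
      rw [this] at hsub ⊢
      rw [Finset.subset_empty.1 hsub]
      simp [h0]
  rw [h1, h2]
  ring

lemma sum_perm_prod_count_partition {α : Type*} [Fintype α] [DecidableEq α] (w : ℕ → ℂ) {n : ℕ}
    (hn : Fintype.card α = n) :
    ∑ σ : Equiv.Perm α, ∏ j ∈ Finset.Icc 1 n, w j ^ σ.partition.parts.count j =
      n.factorial * cycleIndexSum (fun j => w j / j) n n := by
  subst hn
  classical
  rw [cycleIndexSum, Finset.mul_sum, ← Finset.sum_fiberwise Finset.univ Equiv.Perm.partition]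
  refine Finset.sum_congr rfl fun p _ => ?_
  rw [Finset.sum_congr rfl (g := fun _ => ∏ j ∈ Finset.Icc 1 (Fintype.card α),
    w j ^ p.parts.count j) fun σ hσ => by rw [(Finset.mem_filter.1 hσ).2]]
  rw [Finset.sum_const, nsmul_eq_mul, ← card_partition_eq_mul p]
  push_cast
  rw [mul_assoc, cycleIndexWeight, ← Finset.prod_mul_distrib]
  congr 1
  refine Finset.prod_congr rfl fun j hj => ?_
  have h1 : (j : ℂ) ≠ 0 := by
    have := (Finset.mem_Icc.1 hj).1
    exact_mod_cast (by omega : j ≠ 0)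
  have h2 : ((p.parts.count j).factorial : ℂ) ≠ 0 :=
    Nat.cast_ne_zero.2 (Nat.factorial_ne_zero _)
  rw [div_pow]
  field_simp

lemma cycleCount_eq_count_partition {n j : ℕ} (hj : 1 ≤ j) (σ : Equiv.Perm (Fin n)) :
    cycleCount n j σ = σ.partition.parts.count j := by
  rw [Equiv.Perm.parts_partition, Multiset.count_add, Multiset.count_replicate, cycleCount]
  split_ifs with h1 h2 h2
  · subst h1
    rw [Multiset.count_eq_zero_of_notMem, Fintype.card_fin, zero_add]
    intro h
    exact absurd (Equiv.Perm.two_le_of_mem_cycleType h) (by norm_num)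
  · omega
  · omega
  · rfl

lemma numCycles_eq_sum_cycleCount {n : ℕ} (σ : Equiv.Perm (Fin n)) :
    numCycles n σ = ∑ j ∈ Finset.Icc 1 n, cycleCount n j σ := by
  rw [Finset.sum_congr rfl fun j hj =>
    cycleCount_eq_count_partition (Finset.mem_Icc.1 hj).1 σ]
  have h : numCycles n σ = σ.partition.parts.card := by
    rw [Equiv.Perm.parts_partition, Multiset.card_add, Multiset.card_replicate, numCycles,
      Fintype.card_fin, add_comm]
  rw [h]
  symm
  apply Multiset.sum_count_eq_card
  intro i hi
  have := σ.partition.le_of_mem_parts hi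
  rw [Fintype.card_fin] at this
  exact Finset.mem_Icc.2 ⟨σ.partition.parts_pos hi, this⟩

/-- The cycle generating function of the generalized Ewens weights. -/
lemma sum_pow_numCycles_mul_ewensWeight (θ : ℕ → ℝ) (n : ℕ) (z : ℂ) :
    ∑ σ : Equiv.Perm (Fin n), z ^ numCycles n σ * (ewensWeight θ n σ : ℂ) =
      n.factorial * cycleIndexSum (fun j => z * thetaCoeff θ j) n n := by
  have h := sum_perm_prod_count_partition (fun j => z * θ j) (Fintype.card_fin n)
  have hy : cycleIndexSum (fun j => z * thetaCoeff θ j) n n =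
      cycleIndexSum (fun j => z * θ j / j) n n := by
    unfold cycleIndexSum cycleIndexWeight
    refine Finset.sum_congr rfl fun p _ => Finset.prod_congr rfl fun j hj => ?_
    have : j ≠ 0 := by have := (Finset.mem_Icc.1 hj).1; omega
    simp [thetaCoeff, this, mul_div_assoc]
  rw [hy, ← h]
  refine Finset.sum_congr rfl fun σ _ => ?_
  rw [ewensWeight, numCycles_eq_sum_cycleCount, ← Finset.prod_pow_eq_pow_sum]
  push_cast
  rw [← Finset.prod_mul_distrib]
  refine Finset.prod_congr rfl fun j hj => ?_
  rw [mul_pow, cycleCount_eq_count_partition (Finset.mem_Icc.1 hj).1]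

/-- Cauchy's formula for Taylor coefficients as a Fourier integral. -/
lemma intervalIntegral_exp_neg_mul_eq_iteratedDeriv {F : ℂ → ℂ} {ρ t : ℝ} (ht : 0 < t) (htρ : t < ρ)
    (hF : DifferentiableOn ℂ F (Metric.ball 0 ρ)) (n : ℕ) :
    ∫ φ in -Real.pi..Real.pi,
        F (t * Complex.exp (φ * Complex.I)) * Complex.exp (-(n * φ * Complex.I)) =
      2 * Real.pi * t ^ n * (iteratedDeriv n F 0 / n.factorial) := by
  have hd : DiffContOnCl ℂ F (Metric.ball 0 t) := by
    refine DifferentiableOn.diffContOnCl (hF.mono ?_)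
    rw [closure_ball _ ht.ne']
    exact Metric.closedBall_subset_ball htρ
  lift t to NNReal using ht.le
  have hp := hd.hasFPowerSeriesOnBall (by exact_mod_cast ht)
  have h1 := hp.factorial_smul (t : ℂ) n
  rw [iteratedFDeriv_apply_eq_iteratedDeriv_mul_prod, Finset.prod_const, Finset.card_univ,
    Fintype.card_fin, cauchyPowerSeries_apply] at h1
  have hper : Function.Periodic (fun φ : ℝ => F (t * Complex.exp (φ * Complex.I)) *
      Complex.exp (-(n * φ * Complex.I))) (2 * Real.pi) := by
    intro φ
    have e1 : Complex.exp (((φ + 2 * Real.pi : ℝ) : ℂ) * Complex.I) =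
        Complex.exp (φ * Complex.I) := by
      rw [← Complex.exp_periodic (φ * Complex.I)]; push_cast; ring_nf
    have e2 : Complex.exp (-(n * ((φ + 2 * Real.pi : ℝ) : ℂ) * Complex.I)) =
        Complex.exp (-(n * φ * Complex.I)) := by
      have := Complex.exp_periodic.sub_nat_mul_eq n (x := -(n * φ * Complex.I))
      rw [← this]; push_cast; congr 1; ring
    simp only [e1, e2]
  have h2 := hper.intervalIntegral_add_eq (-Real.pi) 0
  rw [show -Real.pi + 2 * Real.pi = Real.pi by ring, zero_add] at h2
  rw [h2]
  have h3 : (∮ z in C(0, (t : ℝ)), ((t : ℂ) / (z - 0)) ^ n • (z - 0)⁻¹ • F z) =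
      Complex.I * ∫ φ in (0 : ℝ)..(2 * Real.pi),
        F (t * Complex.exp (φ * Complex.I)) * Complex.exp (-(n * φ * Complex.I)) := by
    rw [circleIntegral, ← intervalIntegral.integral_const_mul]
    refine intervalIntegral.integral_congr fun φ _ => ?_
    have ht' : (t : ℂ) ≠ 0 := by
      have : (t : ℝ) ≠ 0 := ht.ne'
      exact_mod_cast this
    have e3 : Complex.exp (-(n * φ * Complex.I)) = (Complex.exp (φ * Complex.I) ^ n)⁻¹ := by
      rw [← Complex.exp_nat_mul, ← Complex.exp_neg]; ring_nf
    have e4 := Complex.exp_ne_zero (φ * Complex.I)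
    simp only [deriv_circleMap, circleMap, sub_zero, zero_add, smul_eq_mul, e3, div_pow, mul_pow,
      mul_inv]
    have ht'' : ((t : ℝ) : ℂ) ≠ 0 := by exact_mod_cast ht.ne'
    field_simp
  rw [h3] at h1
  have hn : (n.factorial : ℂ) ≠ 0 := Nat.cast_ne_zero.2 (Nat.factorial_ne_zero _)
  have hpi : (Real.pi : ℂ) ≠ 0 := by exact_mod_cast Real.pi_ne_zero
  rw [nsmul_eq_mul, smul_eq_mul, smul_eq_mul] at h1
  rw [mul_div_assoc', eq_div_iff hn, mul_assoc _ _ (iteratedDeriv n F 0), ← h1]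
  generalize (∫ φ in (0 : ℝ)..(2 * Real.pi),
        F (t * Complex.exp (φ * Complex.I)) * Complex.exp (-(n * φ * Complex.I))) = J
  field_simp

section Series

variable {θ : ℕ → ℝ} {ρ : ℝ}
  (hs : ∀ z : ℂ, ‖z‖ < ρ → HasSum (fun n => (thetaCoeff θ n : ℂ) * z ^ n) (gThetaC θ z))

include hs

lemma hasFPowerSeriesAt_gThetaC (hρ : 0 < ρ) :
    HasFPowerSeriesAt (gThetaC θ)
      (FormalMultilinearSeries.ofScalars ℂ (fun n => (thetaCoeff θ n : ℂ))) 0 := by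
  rw [hasFPowerSeriesAt_iff]
  filter_upwards [Metric.ball_mem_nhds (0 : ℂ) hρ] with z hz
  have := hs z (by simpa using hz)
  simpa [FormalMultilinearSeries.coeff_ofScalars, mul_comm] using this

lemma iteratedDeriv_gThetaC (hρ : 0 < ρ) (n : ℕ) :
    iteratedDeriv n (gThetaC θ) 0 = n.factorial * thetaCoeff θ n := by
  have h := hasFPowerSeriesAt_gThetaC hs hρ
  obtain ⟨R, hR⟩ := h
  have h1 := hR.factorial_smul (1 : ℂ) n
  rw [iteratedFDeriv_apply_eq_iteratedDeriv_mul_prod] at h1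
  simpa [FormalMultilinearSeries.ofScalars_apply_eq] using h1.symm

lemma differentiableOn_gThetaC : DifferentiableOn ℂ (gThetaC θ) (Metric.ball 0 ρ) := by
  intro z hz
  have hz' : ‖z‖ < ρ := by simpa using hz
  obtain ⟨R, hzR, hRρ⟩ := exists_between hz'
  have hR : 0 < R := (norm_nonneg z).trans_lt hzR
  set p := FormalMultilinearSeries.ofScalars ℂ (fun n => (thetaCoeff θ n : ℂ))
  have hball : HasFPowerSeriesOnBall (gThetaC θ) p 0 (ENNReal.ofReal R) := by
    refine ⟨?_, by simpa using hR, ?_⟩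
    · rw [ENNReal.ofReal]
      refine p.le_radius_of_summable ?_
      have h1 : ‖(R : ℂ)‖ < ρ := by simpa [abs_of_pos hR] using hRρ
      have h2 := (hs R h1).summable.norm
      simpa [p, FormalMultilinearSeries.ofScalars_norm, abs_of_pos hR, hR.le] using h2
    · intro y hy
      have : ‖y‖ < ρ := by
        refine lt_trans ?_ hRρ
        rw [Metric.eball_ofReal] at hy
        simpa using hy
      have h := hs y this
      simpa [p, FormalMultilinearSeries.ofScalars_apply_eq, mul_comm] using h
  have hz2 : z ∈ Metric.eball (0 : ℂ) (ENNReal.ofReal R) := by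
    rw [Metric.eball_ofReal]; simpa using hzR
  exact (hball.analyticOnNhd z hz2).differentiableAt.differentiableWithinAt

lemma iteratedDeriv_exp_mul_gThetaC (hρ : 0 < ρ) (z : ℂ) {N n : ℕ} (hn : n ≤ N) :
    iteratedDeriv n (fun t => Complex.exp (z * gThetaC θ t)) 0 =
      n.factorial * cycleIndexSum (fun j => z * thetaCoeff θ j) N n := by
  have hG := differentiableOn_gThetaC hs
  have hball : Metric.ball (0 : ℂ) ρ ∈ 𝓝 0 := Metric.ball_mem_nhds 0 hρ
  have hGa : AnalyticAt ℂ (gThetaC θ) 0 := hG.analyticAt hball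
  have hFa : AnalyticAt ℂ (fun t => Complex.exp (z * gThetaC θ t)) 0 := by fun_prop
  induction n using Nat.strong_induction_on with
  | _ n ih =>
    rcases n with _ | n
    · have h0 : gThetaC θ 0 = 0 := by
        have := iteratedDeriv_gThetaC hs hρ 0
        simpa [thetaCoeff] using this
      simp [cycleIndexSum_zero, h0]
    · have hderiv : deriv (fun t => Complex.exp (z * gThetaC θ t)) =ᶠ[𝓝 0]
          (fun t => z * deriv (gThetaC θ) t) * fun t => Complex.exp (z * gThetaC θ t) := by
        filter_upwards [eventually_mem_nhds_iff.2 hball] with t ht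
        have := ((hG.differentiableAt ht).hasDerivAt.const_mul z).cexp.deriv
        simp only [Pi.mul_apply]
        rw [this, mul_comm]
      have hdG : AnalyticAt ℂ (fun t => z * deriv (gThetaC θ) t) 0 :=
        analyticAt_const.mul hGa.deriv
      rw [iteratedDeriv_succ', hderiv.iteratedDeriv_eq,
        iteratedDeriv_mul hdG.contDiffAt hFa.contDiffAt]
      have hrec := nat_mul_cycleIndexSum (fun j => z * thetaCoeff θ j) hn
      have h1 : ((n + 1 : ℕ).factorial : ℂ) = n.factorial * (n + 1 : ℕ) := by
        rw [Nat.factorial_succ]; push_cast; ring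
      rw [h1, mul_assoc, hrec, Finset.mul_sum, Finset.range_eq_Ico,
        show Finset.Icc 1 (n + 1) = Finset.Ico (0 + 1) (n + 1 + 1) from rfl,
        ← Finset.sum_Ico_add']
      refine Finset.sum_congr rfl fun i hi => ?_
      have hin : i ≤ n := by have := (Finset.mem_Ico.1 hi).2; lia
      have h2 : iteratedDeriv i (fun t => z * deriv (gThetaC θ) t) 0 =
          z * ((i + 1).factorial * thetaCoeff θ (i + 1)) := by
        rw [iteratedDeriv_const_mul_field, ← iteratedDeriv_succ', iteratedDeriv_gThetaC hs hρ]
      rw [h2, ih (n - i) (by lia) (by lia), ← Nat.choose_mul_factorial_mul_factorial hin,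
        Nat.factorial_succ, show n + 1 - (i + 1) = n - i by lia]
      push_cast
      ring

end Series

lemma norm_exp_mul_I_sub_sum_le_of_nonneg (n : ℕ) {x : ℝ} (hx : 0 ≤ x) :
    ‖Complex.exp (x * Complex.I) - ∑ j ∈ Finset.range n, (x * Complex.I) ^ j / j.factorial‖ ≤
      x ^ n / n.factorial := by
  induction n generalizing x with
  | zero => simp [Complex.norm_exp_ofReal_mul_I]
  | succ n ih =>
    have hd : ∀ y : ℝ, HasDerivAt (fun y : ℝ => Complex.exp (y * Complex.I) -
        ∑ j ∈ Finset.range (n + 1), (y * Complex.I) ^ j / j.factorial)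
        ((Complex.exp (y * Complex.I) -
          ∑ j ∈ Finset.range n, (y * Complex.I) ^ j / j.factorial) * Complex.I) y := by
      intro y
      have h1 : HasDerivAt (fun y : ℝ => (y : ℂ) * Complex.I) Complex.I y := by
        simpa using (Complex.ofRealCLM.hasDerivAt (x := y)).mul_const Complex.I
      simp only [Finset.sum_range_succ' _ n, pow_zero]
      have h2 : HasDerivAt (fun y : ℝ => ∑ j ∈ Finset.range n,
          ((y : ℂ) * Complex.I) ^ (j + 1) / (j + 1).factorial)
          (∑ j ∈ Finset.range n, ((y : ℂ) * Complex.I) ^ j / j.factorial * Complex.I) y := by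
        refine HasDerivAt.fun_sum fun j _ => ?_
        refine ((h1.pow (j + 1)).div_const ((j + 1).factorial : ℂ)).congr_deriv ?_
        rw [Nat.factorial_succ]
        have : (j.factorial : ℂ) ≠ 0 := Nat.cast_ne_zero.2 (Nat.factorial_ne_zero _)
        have : (j + 1 : ℂ) ≠ 0 := by exact_mod_cast Nat.succ_ne_zero j
        push_cast
        field_simp
      refine (h1.cexp.fun_sub (h2.add_const _)).congr_deriv ?_
      rw [sub_mul, Finset.sum_mul]
    have hB : ∀ y : ℝ, HasDerivAt (fun y : ℝ => y ^ (n + 1) / ((n + 1).factorial : ℝ))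
        (y ^ n / n.factorial) y := by
      intro y
      refine ((hasDerivAt_pow (n + 1) y).div_const ((n + 1).factorial : ℝ)).congr_deriv ?_
      rw [Nat.factorial_succ]
      have : (n.factorial : ℝ) ≠ 0 := Nat.cast_ne_zero.2 (Nat.factorial_ne_zero _)
      push_cast
      field_simp
    refine image_norm_le_of_norm_deriv_right_le_deriv_boundary (a := 0) (b := x)
      (fun y _ => (hd y).continuousAt.continuousWithinAt)
      (fun y _ => (hd y).hasDerivWithinAt) ?_ hB (fun y hy => ?_) ⟨hx, le_rfl⟩
    · simp [Finset.sum_range_succ' _ n]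
    · rw [norm_mul, Complex.norm_I, mul_one]
      exact ih hy.1

lemma norm_exp_mul_I_sub_sum_le (n : ℕ) (x : ℝ) :
    ‖Complex.exp (x * Complex.I) - ∑ j ∈ Finset.range n, (x * Complex.I) ^ j / j.factorial‖ ≤
      |x| ^ n / n.factorial := by
  rcases le_total 0 x with hx | hx
  · rw [abs_of_nonneg hx]
    exact norm_exp_mul_I_sub_sum_le_of_nonneg n hx
  · rw [abs_of_nonpos hx]
    convert norm_exp_mul_I_sub_sum_le_of_nonneg n (neg_nonneg.2 hx) using 1
    rw [← Complex.norm_conj]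
    simp [← Complex.exp_conj]

lemma norm_exp_mul_I_sub_quadratic_le (x : ℝ) :
    ‖Complex.exp (x * Complex.I) - (1 + x * Complex.I - (x : ℂ) ^ 2 / 2)‖ ≤ |x| ^ 3 / 6 := by
  have h := norm_exp_mul_I_sub_sum_le 3 x
  convert h using 2
  · simp [Finset.sum_range_succ, Nat.factorial, mul_pow]
    ring
  · norm_num [Nat.factorial]

lemma norm_exp_mul_I_sub_cubic_le (x : ℝ) :
    ‖Complex.exp (x * Complex.I) -
      (1 + x * Complex.I - (x : ℂ) ^ 2 / 2 - (x : ℂ) ^ 3 / 6 * Complex.I)‖ ≤ |x| ^ 4 / 24 := by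
  have h := norm_exp_mul_I_sub_sum_le 4 x
  convert h using 2
  · simp [Finset.sum_range_succ, Nat.factorial, mul_pow, pow_succ]
    ring_nf
    try ring
  · norm_num [Nat.factorial]

/-! ### Nonnegative sequences with finite moments -/

/-- The `j`-th moment of a sequence of weights. -/
def moment (m : ℕ → ℝ) (j : ℕ) : ℝ := ∑' k : ℕ, (k : ℝ) ^ j * m k

/-- A nonnegative sequence all of whose moments are finite. -/
structure HasMoments (m : ℕ → ℝ) : Prop where
  nonneg : ∀ k, 0 ≤ m k
  summable : ∀ j, Summable fun k : ℕ => (k : ℝ) ^ j * m k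

namespace HasMoments

variable {m : ℕ → ℝ} (hm : HasMoments m)
include hm

lemma hasSum (j : ℕ) : HasSum (fun k : ℕ => (k : ℝ) ^ j * m k) (moment m j) :=
  (hm.summable j).hasSum

lemma hasSum_zero : HasSum m (moment m 0) := by simpa using hm.hasSum 0

lemma moment_nonneg (j : ℕ) : 0 ≤ moment m j :=
  tsum_nonneg fun k => mul_nonneg (by positivity) (hm.nonneg k)

lemma hasSum_quadratic (j : ℕ) (u v w : ℝ) :
    HasSum (fun k : ℕ => (k : ℝ) ^ j * (u + v * k + w * (k : ℝ) ^ 2) * m k)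
      (u * moment m j + v * moment m (j + 1) + w * moment m (j + 2)) := by
  convert! (((hm.hasSum j).mul_left u).add ((hm.hasSum (j + 1)).mul_left v)).add
    ((hm.hasSum (j + 2)).mul_left w) using 2
  ring

lemma moment_two_sq_le : moment m 2 ^ 2 ≤ moment m 1 * moment m 3 := by
  have key : ∀ x : ℝ, 0 ≤ x ^ 2 * moment m 1 + (-2 * x) * moment m 2 + 1 * moment m 3 := by
    intro x
    refine (hm.hasSum_quadratic 1 (x ^ 2) (-2 * x) 1).nonneg fun k => ?_
    have : x ^ 2 + -2 * x * (k : ℝ) + 1 * (k : ℝ) ^ 2 = (x - k) ^ 2 := by ring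
    rw [this]
    have := hm.nonneg k
    positivity
  have := discrim_le_zero (a := moment m 1) (b := -2 * moment m 2) (c := moment m 3)
    (fun x => by have := key x; nlinarith)
  rw [discrim] at this
  nlinarith

end HasMoments

/-- The Fourier series with coefficients `m`. -/
def charSum (m : ℕ → ℝ) (φ : ℝ) : ℂ := ∑' k : ℕ, (m k : ℂ) * Complex.exp ((k * φ : ℝ) * Complex.I)

namespace HasMoments

variable {m : ℕ → ℝ} (hm : HasMoments m)
include hm

lemma hasSum_charSum (φ : ℝ) :
    HasSum (fun k : ℕ => (m k : ℂ) * Complex.exp ((k * φ : ℝ) * Complex.I)) (charSum m φ) := by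
  refine (Summable.of_norm ?_).hasSum
  simpa only [norm_mul, Complex.norm_exp_ofReal_mul_I, Complex.norm_real, Real.norm_eq_abs,
    abs_of_nonneg (hm.nonneg _), mul_one] using hm.hasSum_zero.summable

lemma hasSum_exp_mul_charSum (p q : ℝ) :
    HasSum (fun k : ℕ => (m k : ℂ) * Complex.exp ((p + q * k : ℝ) * Complex.I))
      (Complex.exp (p * Complex.I) * charSum m q) := by
  convert! (hm.hasSum_charSum q).mul_left (Complex.exp (p * Complex.I)) using 2 with k
  rw [mul_left_comm, ← Complex.exp_add]
  push_cast
  ring_nf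

lemma hasSum_ofReal_quadratic (u v w : ℂ) :
    HasSum (fun k : ℕ => (m k : ℂ) * (u + v * k + w * (k : ℂ) ^ 2))
      (u * moment m 0 + v * moment m 1 + w * moment m 2) := by
  have h : ∀ j, HasSum (fun k : ℕ => (((k : ℝ) ^ j * m k : ℝ) : ℂ)) (moment m j : ℂ) :=
    fun j => Complex.hasSum_ofReal.2 (hm.hasSum j)
  convert! (((h 0).mul_left u).add ((h 1).mul_left v)).add ((h 2).mul_left w) using 2 with k
  push_cast
  ring

lemma norm_charSum_sub_cubic_le (φ : ℝ) :
    ‖charSum m φ - (moment m 0 + φ * Complex.I * moment m 1 - (φ : ℂ) ^ 2 / 2 * moment m 2 -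
      (φ : ℂ) ^ 3 / 6 * Complex.I * moment m 3)‖ ≤ φ ^ 4 / 24 * moment m 4 := by
  have h3 : HasSum (fun k : ℕ => (((k : ℝ) ^ 3 * m k : ℝ) : ℂ)) (moment m 3 : ℂ) :=
    Complex.hasSum_ofReal.2 (hm.hasSum 3)
  have h := (hm.hasSum_charSum φ).sub
    ((hm.hasSum_ofReal_quadratic 1 (φ * Complex.I) (-((φ : ℂ) ^ 2 / 2))).sub
      (h3.mul_left ((φ : ℂ) ^ 3 / 6 * Complex.I)))
  have h4 := (hm.hasSum 4).mul_left (φ ^ 4 / 24)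
  have := tsum_of_norm_bounded h4 (f := fun k : ℕ =>
    (m k : ℂ) * Complex.exp ((k * φ : ℝ) * Complex.I) -
      ((m k : ℂ) * (1 + φ * Complex.I * k + -((φ : ℂ) ^ 2 / 2) * (k : ℂ) ^ 2) -
        (φ : ℂ) ^ 3 / 6 * Complex.I * (((k : ℝ) ^ 3 * m k : ℝ) : ℂ))) ?_
  · rw [h.tsum_eq] at this
    convert! this using 2
    ring
  · intro k
    have h5 := mul_le_mul_of_nonneg_left (norm_exp_mul_I_sub_cubic_le (k * φ)) (hm.nonneg k)
    have h6 : ‖(m k : ℂ)‖ = m k := by simp [abs_of_nonneg (hm.nonneg k)]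
    nth_rw 1 [← h6] at h5
    rw [← norm_mul] at h5
    rw [Even.pow_abs (by decide)] at h5
    refine le_trans (le_of_eq ?_) (h5.trans (le_of_eq ?_))
    · congr 1; push_cast; ring
    · ring

/-- The quadratic Taylor expansion at a shifted point with cubic error term. -/
lemma norm_exp_mul_charSum_sub_quadratic_le (s ψ l : ℝ) (hl : l * moment m 2 = moment m 1) :
    ‖Complex.exp (s * Complex.I) * charSum m (ψ - l * s) -
      (moment m 0 + (s * moment m 0 + (ψ - l * s) * moment m 1) * Complex.I -
        (s ^ 2 * (moment m 0 - l * moment m 1) + ψ ^ 2 * moment m 2) / 2)‖ ≤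
      4 / 6 * |s| ^ 3 * ((moment m 0 - l * moment m 1) +
        (|l| * moment m 1 - 2 * |l| * l * moment m 2 + |l| * l ^ 2 * moment m 3)) +
      4 / 6 * |ψ| ^ 3 * moment m 3 := by
  have hq := hm.hasSum_ofReal_quadratic (1 + s * Complex.I - s ^ 2 / 2)
      ((ψ - l * s) * Complex.I - s * (ψ - l * s)) (- (ψ - l * s) ^ 2 / 2)
  have h := (hm.hasSum_exp_mul_charSum s (ψ - l * s)).sub hq
  have hb := (((hm.hasSum_quadratic 0 1 (-2 * l) (l ^ 2)).add
    ((hm.hasSum_quadratic 1 1 (-2 * l) (l ^ 2)).mul_left |l|)).mul_left (4 / 6 * |s| ^ 3)).add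
    ((hm.hasSum 3).mul_left (4 / 6 * |ψ| ^ 3))
  have := tsum_of_norm_bounded hb (f := fun k : ℕ =>
    (m k : ℂ) * Complex.exp ((s + (ψ - l * s) * k : ℝ) * Complex.I) -
      (m k : ℂ) * (1 + s * Complex.I - s ^ 2 / 2 +
        ((ψ - l * s) * Complex.I - s * (ψ - l * s)) * k +
        - (ψ - l * s) ^ 2 / 2 * (k : ℂ) ^ 2)) ?_
  · rw [h.tsum_eq] at this
    refine le_trans (le_of_eq ?_) (this.trans (le_of_eq ?_))
    · congr 2
      have hl' : (moment m 1 : ℂ) = l * moment m 2 := by exact_mod_cast hl.symm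
      rw [hl']
      ring
    · simp only [zero_add, Nat.reduceAdd]
      rw [← hl]
      ring
  · intro k
    have h5 := mul_le_mul_of_nonneg_left
      (norm_exp_mul_I_sub_quadratic_le (s + (ψ - l * s) * k)) (hm.nonneg k)
    have h6 : ‖(m k : ℂ)‖ = m k := by simp [abs_of_nonneg (hm.nonneg k)]
    nth_rw 1 [← h6] at h5
    rw [← norm_mul] at h5
    refine le_trans (le_of_eq ?_) (h5.trans ?_)
    · congr 1; push_cast; ring
    · have e1 : s + (ψ - l * s) * k = s * (1 - l * k) + ψ * k := by ring
      have e2 : |s + (ψ - l * s) * k| ≤ |s| * |1 - l * k| + |ψ| * k := by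
        rw [e1]
        refine (abs_add_le _ _).trans (le_of_eq ?_)
        rw [abs_mul, abs_mul, Nat.abs_cast]
      have e3 : ∀ x y : ℝ, 0 ≤ x → 0 ≤ y → (x + y) ^ 3 ≤ 4 * (x ^ 3 + y ^ 3) := by
        intro x y hx hy
        nlinarith [mul_nonneg (add_nonneg hx hy) (sq_nonneg (x - y))]
      have e4 := (pow_le_pow_left₀ (abs_nonneg _) e2 3).trans
        (e3 _ _ (by positivity) (by positivity))
      have e5 : |1 - l * k| ≤ 1 + |l| * k := by
        refine (abs_sub _ _).trans (le_of_eq ?_)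
        rw [abs_mul, abs_one, Nat.abs_cast]
      have e6 : |1 - l * k| ^ 3 ≤ (1 + |l| * k) * (1 - l * k) ^ 2 := by
        rw [pow_succ', sq_abs]
        exact mul_le_mul_of_nonneg_right e5 (sq_nonneg _)
      have e7 : |s + (ψ - l * s) * k| ^ 3 ≤
          4 * (|s| ^ 3 * ((1 + |l| * k) * (1 - l * k) ^ 2) + |ψ| ^ 3 * k ^ 3) := by
        refine e4.trans ?_
        rw [mul_pow, mul_pow]
        gcongr
      calc _ ≤ m k * (4 * (|s| ^ 3 * ((1 + |l| * k) * (1 - l * k) ^ 2) + |ψ| ^ 3 * k ^ 3) / 6) := by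
            have := hm.nonneg k
            gcongr
        _ = _ := by ring

lemma hasSum_one_sub_cos (p q : ℝ) :
    HasSum (fun k : ℕ => m k * (1 - Real.cos (p + q * k)))
      (moment m 0 - (Complex.exp (p * Complex.I) * charSum m q).re) := by
  have h := Complex.hasSum_re (hm.hasSum_exp_mul_charSum p q)
  convert! hm.hasSum_zero.sub h using 2 with k
  rw [Complex.re_ofReal_mul, Complex.exp_ofReal_mul_I_re]
  ring

lemma hasSum_one_sub_cos_zero (q : ℝ) :
    HasSum (fun k : ℕ => m k * (1 - Real.cos (q * k)))
      (moment m 0 - (charSum m q).re) := by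
  simpa using hm.hasSum_one_sub_cos 0 q

/-- On the minor arcs a small twist costs at most half the decay. -/
lemma half_sub_re_le (s ψ l : ℝ) (hl : l * moment m 2 = moment m 1) :
    (moment m 0 - (charSum m ψ).re) / 2 - s ^ 2 / 2 * (moment m 0 - l * moment m 1) ≤
      moment m 0 - (Complex.exp (s * Complex.I) * charSum m (ψ - l * s)).re := by
  have h1 := ((hm.hasSum_one_sub_cos_zero ψ).div_const 2).sub
    ((hm.hasSum_quadratic 0 1 (-2 * l) (l ^ 2)).mul_left (s ^ 2 / 2))
  have h2 := hasSum_le (fun k => ?_) h1 (hm.hasSum_one_sub_cos s (ψ - l * s))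
  · refine le_trans (le_of_eq ?_) h2
    simp only [zero_add]
    rw [← hl]
    ring
  · have key : ∀ x y : ℝ, 1 - Real.cos x ≤ 2 * (1 - Real.cos (x + y)) + 2 * (y ^ 2 / 2) := by
      intro x y
      have h3 : 1 - Real.cos y ≤ y ^ 2 / 2 := by
        have := Real.one_sub_sq_div_two_le_cos (x := y); linarith
      have h4 : 1 - Real.cos x ≤ 2 * (1 - Real.cos (x + y)) + 2 * (1 - Real.cos y) := by
        have e1 : Real.cos x = Real.cos (x + y) * Real.cos y + Real.sin (x + y) * Real.sin y := by
          rw [← Real.cos_sub]; ring_nf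
        rw [e1]
        have e2 := Real.sin_sq_add_cos_sq (x + y)
        have e3 := Real.sin_sq_add_cos_sq y
        nlinarith [sq_nonneg (Real.sin (x + y) + Real.sin y),
          sq_nonneg (Real.cos (x + y) + Real.cos y - 2)]
      linarith
    have h5 := key (ψ * k) (s * (1 - l * k))
    have h6 := mul_le_mul_of_nonneg_left h5 (hm.nonneg k)
    have e : ψ * k + s * (1 - l * k) = s + (ψ - l * s) * k := by ring
    rw [e] at h6
    nlinarith

/-- The residual variance dominates the decay of the characteristic sum at `2πl`. -/
lemma sub_re_charSum_le (l : ℝ) (hl : l * moment m 2 = moment m 1) :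
    moment m 0 - (charSum m (2 * Real.pi * l)).re ≤
      2 * Real.pi ^ 2 * (moment m 0 - l * moment m 1) := by
  have h1 := (hm.hasSum_quadratic 0 1 (-2 * l) (l ^ 2)).mul_left (2 * Real.pi ^ 2)
  have h2 := hasSum_le (fun k => ?_) (hm.hasSum_one_sub_cos_zero (2 * Real.pi * l)) h1
  · refine h2.trans (le_of_eq ?_)
    simp only [zero_add]
    rw [← hl]
    ring
  · have h3 : 1 - Real.cos (2 * Real.pi * l * k) ≤ (2 * Real.pi * l * k - 2 * Real.pi) ^ 2 / 2 := by
      have := Real.one_sub_sq_div_two_le_cos (x := 2 * Real.pi * l * k - 2 * Real.pi)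
      rw [Real.cos_sub_two_pi] at this
      linarith
    have h4 := mul_le_mul_of_nonneg_left h3 (hm.nonneg k)
    refine h4.trans (le_of_eq ?_)
    ring

end HasMoments

/-- The tilted weights `g_k t ^ k`. -/
def thetaWeights (θ : ℕ → ℝ) (t : ℝ) : ℕ → ℝ := fun k => thetaCoeff θ k * t ^ k

lemma moment_thetaWeights_zero (θ : ℕ → ℝ) (t : ℝ) :
    moment (thetaWeights θ t) 0 = gThetaR θ t := by
  simp [moment, thetaWeights, gThetaR]

lemma gThetaC_mul_exp (θ : ℕ → ℝ) (t φ : ℝ) :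
    gThetaC θ (t * Complex.exp (φ * Complex.I)) = charSum (thetaWeights θ t) φ := by
  refine tsum_congr fun k => ?_
  rw [mul_pow, ← Complex.exp_nat_mul, thetaWeights]
  push_cast
  ring_nf

lemma gThetaC_ofReal (θ : ℕ → ℝ) (t : ℝ) : gThetaC θ t = moment (thetaWeights θ t) 0 := by
  rw [moment, Complex.ofReal_tsum]
  refine tsum_congr fun k => ?_
  simp [thetaWeights]

namespace IsLogAdmissible

variable {θ : ℕ → ℝ} {ρ : ℝ} {a b δ : ℝ → ℝ}
  (hadm : IsLogAdmissible (gThetaC θ) (thetaCoeff θ) ρ a b δ)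
include hadm

lemma hasMoments {t : ℝ} (ht : t ∈ Ioo 0 ρ) : HasMoments (thetaWeights θ t) := by
  refine ⟨fun k => mul_nonneg (hadm.coeff_nonneg k) (pow_nonneg ht.1.le k), fun j => ?_⟩
  obtain ⟨s, hts, hsρ⟩ := exists_between ht.2
  have hs : 0 < s := ht.1.trans hts
  have h1 : Summable fun k => thetaCoeff θ k * s ^ k := by
    have := (hadm.series s (by simpa [abs_of_pos hs] using hsρ)).summable.norm
    simpa [abs_of_nonneg (hadm.coeff_nonneg _), abs_of_pos hs] using this
  have hq : ‖t / s‖ < 1 := by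
    rw [Real.norm_eq_abs, abs_of_pos (div_pos ht.1 hs), div_lt_one hs]; exact hts
  obtain ⟨B, hB⟩ :=
    (summable_pow_mul_geometric_of_norm_lt_one j hq).tendsto_atTop_zero.bddAbove_range
  refine Summable.of_nonneg_of_le (fun k => ?_) (fun k => ?_) (h1.mul_left B)
  · have := hadm.coeff_nonneg k
    have := ht.1
    simp only [thetaWeights]
    positivity
  · have h2 : (k : ℝ) ^ j * (t / s) ^ k ≤ B := hB ⟨k, rfl⟩
    have h3 := mul_le_mul_of_nonneg_right h2
      (mul_nonneg (hadm.coeff_nonneg k) (pow_nonneg hs.le k))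
    refine le_trans (le_of_eq ?_) h3
    rw [thetaWeights, div_pow]
    field_simp

lemma hasDerivAt_moment {t : ℝ} (ht : t ∈ Ioo 0 ρ) (j : ℕ) :
    HasDerivAt (fun t => moment (thetaWeights θ t) j)
      (moment (thetaWeights θ t) (j + 1) / t) t := by
  obtain ⟨s, hts, hsρ⟩ := exists_between ht.2
  have hs : 0 < s := ht.1.trans hts
  have hu := ((hadm.hasMoments ⟨hs, hsρ⟩).summable (j + 1)).div_const s
  have h := hasDerivAt_tsum_of_isPreconnected (𝕜 := ℝ) (F := ℝ)
    (g := fun (k : ℕ) t => (k : ℝ) ^ j * (thetaCoeff θ k * t ^ k))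
    (g' := fun (k : ℕ) t => (k : ℝ) ^ j * (thetaCoeff θ k * (k * t ^ (k - 1))))
    hu (t := Ioo 0 s) isOpen_Ioo isPreconnected_Ioo
    (fun k y _ => ((hasDerivAt_pow k y).const_mul _).const_mul _) ?_ ⟨ht.1, hts⟩
    ((hadm.hasMoments ht).summable j) ⟨ht.1, hts⟩
  · refine h.congr_deriv ?_
    rw [moment, ← tsum_div_const]
    refine tsum_congr fun k => ?_
    rcases k with _ | k
    · simp
    · have := ht.1.ne'
      rw [thetaWeights, pow_succ' t]
      simp only [Nat.add_sub_cancel]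
      field_simp
      ring
  · intro k y hy
    have hc := hadm.coeff_nonneg k
    have hy0 := hy.1
    rw [Real.norm_of_nonneg (by positivity)]
    rcases k with _ | k
    · simp
    · have h1 : y ^ k ≤ s ^ k := pow_le_pow_left₀ hy.1.le hy.2.le k
      rw [thetaWeights, pow_succ' s]
      simp only [Nat.add_sub_cancel]
      calc _ ≤ ((k + 1 : ℕ) : ℝ) ^ j * (thetaCoeff θ (k + 1) * ((k + 1 : ℕ) * s ^ k)) := by gcongr
        _ = _ := by field_simp; ring

variable (ha : ∀ t ∈ Set.Ico (0 : ℝ) ρ, a t = t * deriv (gThetaR θ) t)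
include ha

lemma a_eq {t : ℝ} (ht : t ∈ Ioo 0 ρ) : a t = moment (thetaWeights θ t) 1 := by
  have h := hadm.hasDerivAt_moment ht 0
  have : (fun t => moment (thetaWeights θ t) 0) = gThetaR θ :=
    funext (moment_thetaWeights_zero θ)
  rw [this] at h
  rw [ha t ⟨ht.1.le, ht.2⟩, h.deriv, mul_div_cancel₀ _ ht.1.ne']

omit ha in
lemma eventually_mem_Ioo : ∀ᶠ t in 𝓝[<] ρ, t ∈ Ioo 0 ρ :=
  Ioo_mem_nhdsLT hadm.rho_pos

lemma tendsto_moment_one : Tendsto (fun t => moment (thetaWeights θ t) 1) (𝓝[<] ρ) atTop := by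
  refine hadm.a_div.congr' ?_
  filter_upwards [hadm.eventually_mem_Ioo] with t ht
  exact hadm.a_eq ha ht

lemma exists_coeff_pos : ∃ k, k ≠ 0 ∧ 0 < thetaCoeff θ k := by
  by_contra! h
  have h0 : ∀ t, moment (thetaWeights θ t) 1 = 0 := by
    intro t
    rw [moment]
    convert! tsum_zero with k
    rcases eq_or_ne k 0 with rfl | hk
    · simp
    · have := le_antisymm (h k hk) (hadm.coeff_nonneg k)
      simp [thetaWeights, this]
  have := hadm.tendsto_moment_one ha
  simp only [h0] at this
  obtain ⟨t, ht⟩ := (this.eventually_ge_atTop 1).exists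
  linarith

lemma moment_pos {t : ℝ} (ht : t ∈ Ioo 0 ρ) (j : ℕ) : 0 < moment (thetaWeights θ t) j := by
  obtain ⟨k, hk, hpos⟩ := hadm.exists_coeff_pos ha
  have hm := hadm.hasMoments ht
  refine (hm.summable j).tsum_pos (fun i => mul_nonneg (by positivity) (hm.nonneg i)) k ?_
  have := ht.1
  have : (0 : ℝ) < k := by exact_mod_cast Nat.pos_of_ne_zero hk
  rw [thetaWeights]
  positivity

end IsLogAdmissible

lemma le_of_forall_mul_le_of_small {x y z η : ℝ} (hη : 0 < η)
    (h : ∀ φ : ℝ, 0 < φ → φ ≤ η → x ≤ y + φ * z) : x ≤ y := by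
  have h1 : Tendsto (fun φ : ℝ => y + φ * z) (𝓝[>] 0) (𝓝 (y + 0 * z)) := by
    refine Tendsto.mono_left ?_ nhdsWithin_le_nhds
    exact (by fun_prop : Continuous fun φ : ℝ => y + φ * z).tendsto 0
  rw [zero_mul, add_zero] at h1
  refine ge_of_tendsto h1 ?_
  filter_upwards [Ioc_mem_nhdsGT hη] with φ hφ using h φ hφ.1 hφ.2

namespace IsLogAdmissible

variable {θ : ℕ → ℝ} {ρ : ℝ} {a b δ : ℝ → ℝ}
  (hadm : IsLogAdmissible (gThetaC θ) (thetaCoeff θ) ρ a b δ)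
  (ha : ∀ t ∈ Set.Ico (0 : ℝ) ρ, a t = t * deriv (gThetaR θ) t)
include hadm ha

/-- The approximation condition determines `b` and controls the third moment. -/
lemma moment_of_approx {t : ℝ} (ht : t ∈ Ioo 0 ρ) {E : ℝ}
    (happ : ∀ φ : ℝ, |φ| ≤ δ t →
      ‖gThetaC θ (t * Complex.exp (φ * Complex.I)) -
          (gThetaC θ t + φ * Complex.I * a t - (φ : ℂ) ^ 2 / 2 * b t)‖ ≤
        E * |φ| ^ 3) :
    b t = moment (thetaWeights θ t) 2 ∧ moment (thetaWeights θ t) 3 ≤ 6 * E := by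
  have hm := hadm.hasMoments ht
  have hδ := hadm.delta_pos t ⟨ht.1.le, ht.2⟩
  set M := moment (thetaWeights θ t) with hM
  have hM4 := hm.moment_nonneg 4
  have key : ∀ φ : ℝ, 0 < φ → φ ≤ δ t →
      ‖((φ ^ 2 / 2 * (b t - M 2) : ℝ) : ℂ) - ((φ ^ 3 / 6 * M 3 : ℝ) : ℂ) * Complex.I‖ ≤
        E * φ ^ 3 + φ ^ 4 / 24 * M 4 := by
    intro φ h0 h1
    have e1 := happ φ (by rwa [abs_of_pos h0])
    have e2 := hm.norm_charSum_sub_cubic_le φ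
    rw [gThetaC_mul_exp, gThetaC_ofReal, hadm.a_eq ha ht, abs_of_pos h0] at e1
    have e3 := (norm_sub_le _ _).trans (add_le_add e1 e2)
    refine le_trans (le_of_eq ?_) e3
    congr 1
    push_cast
    ring
  have hre : ∀ φ : ℝ, 0 < φ → φ ≤ δ t →
      |φ ^ 2 / 2 * (b t - M 2)| ≤ E * φ ^ 3 + φ ^ 4 / 24 * M 4 := by
    intro φ h0 h1
    have := (Complex.abs_re_le_norm _).trans (key φ h0 h1)
    simpa only [Complex.sub_re, Complex.ofReal_re, Complex.re_ofReal_mul, Complex.I_re, mul_zero,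
      sub_zero] using this
  have him : ∀ φ : ℝ, 0 < φ → φ ≤ δ t → φ ^ 3 / 6 * M 3 ≤ E * φ ^ 3 + φ ^ 4 / 24 * M 4 := by
    intro φ h0 h1
    have := (Complex.abs_im_le_norm _).trans (key φ h0 h1)
    simp only [Complex.sub_im, Complex.ofReal_im, Complex.im_ofReal_mul, Complex.I_im, mul_one,
      zero_sub, abs_neg] at this
    exact (le_abs_self _).trans this
  constructor
  · have h1 : |b t - M 2| ≤ 0 := by
      refine le_of_forall_mul_le_of_small (z := 2 * |E| + δ t * M 4 / 12) hδ fun φ h0 h1 => ?_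
      have h2 := hre φ h0 h1
      rw [abs_mul, abs_of_pos (by positivity)] at h2
      have h3 : E ≤ |E| := le_abs_self E
      have h4 : φ ^ 2 * |b t - M 2| ≤ φ ^ 2 * (φ * (2 * |E| + δ t * M 4 / 12)) := by
        have h5 : E * φ ^ 3 ≤ |E| * φ ^ 3 := by gcongr
        have h6 : φ ^ 4 / 24 * M 4 ≤ φ ^ 3 * (δ t) / 24 * M 4 := by
          rw [pow_succ]; gcongr
        nlinarith
      rw [zero_add]
      exact le_of_mul_le_mul_left h4 (by positivity)
    exact sub_eq_zero.1 (abs_nonpos_iff.1 h1)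
  · refine le_of_forall_mul_le_of_small (z := M 4 / 4) hδ fun φ h0 h1 => ?_
    have h2 := him φ h0 h1
    have h4 : φ ^ 3 * M 3 ≤ φ ^ 3 * (6 * E + φ * (M 4 / 4)) := by nlinarith
    exact le_of_mul_le_mul_left h4 (by positivity)

lemma b_eq {t : ℝ} (ht : t ∈ Ioo 0 ρ) : b t = moment (thetaWeights θ t) 2 := by
  obtain ⟨ε, -, h⟩ := hadm.approx
  refine (hadm.moment_of_approx ha ht (E := ε t * (δ t)⁻¹ ^ 3) fun φ hφ => ?_).1
  exact (h t ⟨ht.1.le, ht.2⟩ φ hφ).trans (le_of_eq (by ring))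

lemma tendsto_moment_three_mul :
    Tendsto (fun t => moment (thetaWeights θ t) 3 * δ t ^ 3) (𝓝[<] ρ) (𝓝 0) := by
  obtain ⟨ε, hε, h⟩ := hadm.approx
  have h6 : Tendsto (fun t => 6 * ε t) (𝓝[<] ρ) (𝓝 0) := by simpa using hε.const_mul 6
  refine tendsto_of_tendsto_of_tendsto_of_le_of_le' tendsto_const_nhds h6 ?_ ?_
  · filter_upwards [hadm.eventually_mem_Ioo] with t ht
    have := (hadm.hasMoments ht).moment_nonneg 3
    have := hadm.delta_pos t ⟨ht.1.le, ht.2⟩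
    positivity
  · filter_upwards [hadm.eventually_mem_Ioo] with t ht
    have hδ := hadm.delta_pos t ⟨ht.1.le, ht.2⟩
    have h1 := (hadm.moment_of_approx ha ht (E := ε t * (δ t)⁻¹ ^ 3) fun φ hφ => by
      exact (h t ⟨ht.1.le, ht.2⟩ φ hφ).trans (le_of_eq (by ring))).2
    have h2 := mul_le_mul_of_nonneg_right h1 (pow_nonneg hδ.le 3)
    refine h2.trans (le_of_eq ?_)
    field_simp

lemma tendsto_moment_two : Tendsto (fun t => moment (thetaWeights θ t) 2) (𝓝[<] ρ) atTop := by
  refine hadm.b_div.congr' ?_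
  filter_upwards [hadm.eventually_mem_Ioo] with t ht using hadm.b_eq ha ht

lemma tendsto_width {ε : ℝ} (hε : 0 < ε) :
    Tendsto (fun t => ε * δ t ^ 2 * moment (thetaWeights θ t) 2 -
      Real.log (moment (thetaWeights θ t) 2)) (𝓝[<] ρ) atTop := by
  refine (hadm.width ε hε).congr' ?_
  filter_upwards [hadm.eventually_mem_Ioo] with t ht
  rw [hadm.b_eq ha ht]

lemma tendsto_delta_sq_mul :
    Tendsto (fun t => δ t ^ 2 * moment (thetaWeights θ t) 2) (𝓝[<] ρ) atTop := by
  have h := (hadm.tendsto_width ha one_pos).atTop_add_atTop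
    (Real.tendsto_log_atTop.comp (hadm.tendsto_moment_two ha))
  refine h.congr fun t => ?_
  simp

/-- Decay of the Fourier series off the major arc. -/
lemma exists_minor_arc_bound : ∃ ε : ℝ → ℝ, Tendsto ε (𝓝[<] ρ) (𝓝 0) ∧
    ∀ t ∈ Ioo 0 ρ, ∀ φ : ℝ, δ t ≤ |φ| → |φ| ≤ Real.pi →
      δ t ^ 2 * moment (thetaWeights θ t) 2 / 2 - ε t ≤
        moment (thetaWeights θ t) 0 - (charSum (thetaWeights θ t) φ).re := by
  obtain ⟨ε, hε, h⟩ := hadm.approx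
  refine ⟨ε, hε, fun t ht φ h1 h2 => ?_⟩
  have hδ := hadm.delta_pos t ⟨ht.1.le, ht.2⟩
  have key : ∀ φ : ℝ, |φ| = δ t → (charSum (thetaWeights θ t) φ).re ≤
      moment (thetaWeights θ t) 0 - (δ t ^ 2 * moment (thetaWeights θ t) 2 / 2 - ε t) := by
    intro φ hφ
    have e1 := (Complex.re_le_norm _).trans (h t ⟨ht.1.le, ht.2⟩ φ hφ.le)
    rw [gThetaC_mul_exp, gThetaC_ofReal, hadm.a_eq ha ht, hadm.b_eq ha ht, hφ] at e1
    have e2 : ε t * δ t ^ 3 * (δ t)⁻¹ ^ 3 = ε t := by field_simp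
    have e3 : ((φ : ℂ) ^ 2 / 2 * (moment (thetaWeights θ t) 2 : ℂ)).re =
        φ ^ 2 / 2 * moment (thetaWeights θ t) 2 := by
      have : ((φ : ℂ) ^ 2 / 2 * (moment (thetaWeights θ t) 2 : ℂ)) =
        ((φ ^ 2 / 2 * moment (thetaWeights θ t) 2 : ℝ) : ℂ) := by push_cast; ring
      rw [this, Complex.ofReal_re]
    have e4 : ((φ : ℂ) * Complex.I * (moment (thetaWeights θ t) 1 : ℂ)).re = 0 := by simp
    rw [e2, Complex.sub_re, Complex.sub_re, Complex.add_re, e3, e4, Complex.ofReal_re] at e1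
    have e5 : φ ^ 2 = δ t ^ 2 := by rw [← hφ, sq_abs]
    rw [e5] at e1
    linarith
  have hle : (charSum (thetaWeights θ t) φ).re ≤
      moment (thetaWeights θ t) 0 - (δ t ^ 2 * moment (thetaWeights θ t) 2 / 2 - ε t) := by
    rcases h1.eq_or_lt with h1 | h1
    · exact key φ h1.symm
    · have e := hadm.mono t ⟨ht.1.le, ht.2⟩ φ h1 h2
      rw [gThetaC_mul_exp, gThetaC_mul_exp,
        show (-(δ t : ℂ)) = ((-δ t : ℝ) : ℂ) by push_cast; rfl, gThetaC_mul_exp] at e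
      refine e.trans (max_le (key _ (abs_of_pos hδ)) (key _ ?_))
      rw [abs_neg, abs_of_pos hδ]
  linarith

end IsLogAdmissible

/-- The ratio of the first and second moments of the tilted weights. -/
def momentRatio (θ : ℕ → ℝ) (t : ℝ) : ℝ :=
  moment (thetaWeights θ t) 1 / moment (thetaWeights θ t) 2

/-- The residual variance of the number of cycles at the saddle point. -/
def cycleVar (θ : ℕ → ℝ) (t : ℝ) : ℝ :=
  moment (thetaWeights θ t) 0 - momentRatio θ t * moment (thetaWeights θ t) 1

lemma HasMoments.mul_moment_one_le {m : ℕ → ℝ} (hm : HasMoments m) (K : ℕ) :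
    K * moment m 1 ≤ moment m 2 + K * ∑ k ∈ Finset.range K, k * m k := by
  have h1 : HasSum (fun k => if k < K then (K : ℝ) * (k * m k) else 0)
      (K * ∑ k ∈ Finset.range K, k * m k) := by
    rw [Finset.mul_sum]
    have h := hasSum_sum_of_ne_finset_zero (s := Finset.range K)
      (f := fun k => if k < K then (K : ℝ) * (k * m k) else 0) (L := .unconditional ℕ)
      (fun k hk => if_neg (by simpa using hk))
    rwa [Finset.sum_congr rfl fun k hk => if_pos (Finset.mem_range.1 hk)] at h
  refine hasSum_le (fun k => ?_) ((hm.hasSum 1).mul_left (K : ℝ)) ((hm.hasSum 2).add h1)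
  have h0 := hm.nonneg k
  split_ifs with hk
  · have : 0 ≤ (k : ℝ) ^ 2 * m k := by positivity
    rw [pow_one]; linarith
  · have : (K : ℝ) ≤ k := by exact_mod_cast not_lt.1 hk
    have := mul_le_mul_of_nonneg_right this (mul_nonneg (Nat.cast_nonneg k) h0)
    rw [pow_one]; nlinarith

namespace IsLogAdmissible

variable {θ : ℕ → ℝ} {ρ : ℝ} {a b δ : ℝ → ℝ}
  (hadm : IsLogAdmissible (gThetaC θ) (thetaCoeff θ) ρ a b δ)
  (ha : ∀ t ∈ Set.Ico (0 : ℝ) ρ, a t = t * deriv (gThetaR θ) t)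
include hadm ha

lemma momentRatio_pos {t : ℝ} (ht : t ∈ Ioo 0 ρ) : 0 < momentRatio θ t :=
  div_pos (hadm.moment_pos ha ht 1) (hadm.moment_pos ha ht 2)

lemma momentRatio_mul {t : ℝ} (ht : t ∈ Ioo 0 ρ) :
    momentRatio θ t * moment (thetaWeights θ t) 2 = moment (thetaWeights θ t) 1 :=
  div_mul_cancel₀ _ (hadm.moment_pos ha ht 2).ne'

lemma tendsto_momentRatio : Tendsto (momentRatio θ) (𝓝[<] ρ) (𝓝 0) := by
  rw [Metric.tendsto_nhds]
  intro e he
  obtain ⟨K, hK⟩ := exists_nat_gt (2 / e)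
  have hK0 : (0 : ℝ) < K := lt_trans (by positivity) hK
  filter_upwards [hadm.eventually_mem_Ioo, (hadm.tendsto_moment_one ha).eventually_ge_atTop
    (2 * ∑ k ∈ Finset.range K, k * thetaWeights θ ρ k)] with t ht h1
  have hm := hadm.hasMoments ht
  have h2 := hm.mul_moment_one_le K
  have h3 : ∑ k ∈ Finset.range K, k * thetaWeights θ t k ≤
      ∑ k ∈ Finset.range K, k * thetaWeights θ ρ k := by
    refine Finset.sum_le_sum fun k _ => ?_
    have h4 : t ^ k ≤ ρ ^ k := pow_le_pow_left₀ ht.1.le ht.2.le k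
    have := hadm.coeff_nonneg k
    simp only [thetaWeights]
    gcongr
  have h4 : K * moment (thetaWeights θ t) 1 ≤ 2 * moment (thetaWeights θ t) 2 := by
    nlinarith
  have hpos := hadm.momentRatio_pos ha ht
  rw [dist_zero_right, Real.norm_of_nonneg hpos.le, momentRatio,
    div_lt_iff₀ (hadm.moment_pos ha ht 2)]
  rw [div_lt_iff₀ he] at hK
  have hM := hadm.moment_pos ha ht 1
  nlinarith

lemma eventually_delta_le_momentRatio : ∀ᶠ t in 𝓝[<] ρ, δ t ≤ momentRatio θ t := by
  filter_upwards [hadm.eventually_mem_Ioo,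
    (hadm.tendsto_moment_three_mul ha).eventually_le_const one_pos,
    (hadm.tendsto_delta_sq_mul ha).eventually_ge_atTop 1] with t ht h3 h2
  have hδ := hadm.delta_pos t ⟨ht.1.le, ht.2⟩
  have hM1 := hadm.moment_pos ha ht 1
  have hM2 := hadm.moment_pos ha ht 2
  have hcs := (hadm.hasMoments ht).moment_two_sq_le
  rw [momentRatio, le_div_iff₀ hM2]
  set M := moment (thetaWeights θ t)
  -- `δ³ M₂² ≤ M₁ M₃ δ³ ≤ M₁` and `1 ≤ δ² M₂`
  have h4 : M 2 ^ 2 * δ t ^ 3 ≤ M 1 := by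
    calc M 2 ^ 2 * δ t ^ 3 ≤ M 1 * M 3 * δ t ^ 3 := by gcongr
      _ = M 1 * (M 3 * δ t ^ 3) := by ring
      _ ≤ M 1 * 1 := by gcongr
      _ = M 1 := mul_one _
  calc δ t * M 2 = δ t * M 2 * 1 := by ring
    _ ≤ δ t * M 2 * (δ t ^ 2 * M 2) := by gcongr
    _ = M 2 ^ 2 * δ t ^ 3 := by ring
    _ ≤ M 1 := h4

lemma tendsto_cycleVar : Tendsto (cycleVar θ) (𝓝[<] ρ) atTop := by
  obtain ⟨ε, hε, h⟩ := hadm.exists_minor_arc_bound ha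
  have hlim : Tendsto (fun t => (2 * Real.pi ^ 2)⁻¹ *
      (δ t ^ 2 * moment (thetaWeights θ t) 2 / 2 + (-ε t))) (𝓝[<] ρ) atTop := by
    refine Tendsto.const_mul_atTop (by positivity) ?_
    exact ((hadm.tendsto_delta_sq_mul ha).atTop_div_const two_pos).atTop_add hε.neg
  refine tendsto_atTop_mono' _ ?_ hlim
  filter_upwards [hadm.eventually_mem_Ioo, hadm.eventually_delta_le_momentRatio ha,
    (hadm.tendsto_momentRatio ha).eventually_le_const (show (0 : ℝ) < 1 / 2 by norm_num)]
    with t ht h1 h2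
  have hpos := hadm.momentRatio_pos ha ht
  have hpi := Real.pi_gt_three
  have habs : |2 * Real.pi * momentRatio θ t| = 2 * Real.pi * momentRatio θ t :=
    abs_of_pos (by positivity)
  have h3 := h t ht (2 * Real.pi * momentRatio θ t) (by rw [habs]; nlinarith)
    (by rw [habs]; nlinarith)
  have h4 := (hadm.hasMoments ht).sub_re_charSum_le _ (hadm.momentRatio_mul ha ht)
  rw [inv_mul_le_iff₀ (by positivity), cycleVar]
  linarith

end IsLogAdmissible

namespace IsLogAdmissible

variable {θ : ℕ → ℝ} {ρ : ℝ} {a b δ : ℝ → ℝ}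
  (hadm : IsLogAdmissible (gThetaC θ) (thetaCoeff θ) ρ a b δ)
  (ha : ∀ t ∈ Set.Ico (0 : ℝ) ρ, a t = t * deriv (gThetaR θ) t)
include hadm ha

lemma strictMonoOn_moment_one :
    StrictMonoOn (fun t => moment (thetaWeights θ t) 1) (Ioo 0 ρ) := by
  refine strictMonoOn_of_deriv_pos (convex_Ioo 0 ρ)
    (fun t ht => (hadm.hasDerivAt_moment ht 1).continuousAt.continuousWithinAt) fun t ht => ?_
  rw [interior_Ioo] at ht
  rw [(hadm.hasDerivAt_moment ht 1).deriv]
  exact div_pos (hadm.moment_pos ha ht 2) ht.1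

variable {r : ℝ → ℝ} (hr : ∀ x > 0, r x ∈ Set.Ico 0 ρ ∧ a (r x) = x)
include hr

lemma saddle_mem {x : ℝ} (hx : 0 < x) : r x ∈ Ioo 0 ρ := by
  obtain ⟨h1, h2⟩ := hr x hx
  refine ⟨lt_of_le_of_ne h1.1 fun h => ?_, h1.2⟩
  rw [← h, ha 0 ⟨le_rfl, hadm.rho_pos⟩, zero_mul] at h2
  exact hx.ne h2

lemma moment_one_saddle {x : ℝ} (hx : 0 < x) : moment (thetaWeights θ (r x)) 1 = x := by
  rw [← hadm.a_eq ha (hadm.saddle_mem ha hr hx), (hr x hx).2]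

lemma saddle_moment_one {t : ℝ} (ht : t ∈ Ioo 0 ρ) : r (moment (thetaWeights θ t) 1) = t := by
  have hpos := hadm.moment_pos ha ht 1
  exact (hadm.strictMonoOn_moment_one ha).injOn (hadm.saddle_mem ha hr hpos) ht
    (hadm.moment_one_saddle ha hr hpos)

lemma strictMonoOn_saddle : StrictMonoOn r (Ioi 0) := by
  intro x hx y hy hxy
  refine ((hadm.strictMonoOn_moment_one ha).lt_iff_lt (hadm.saddle_mem ha hr hx)
    (hadm.saddle_mem ha hr hy)).1 ?_
  simpa only [hadm.moment_one_saddle ha hr hx, hadm.moment_one_saddle ha hr hy] using hxy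

lemma tendsto_saddle : Tendsto r atTop (𝓝[<] ρ) := by
  rw [(nhdsLT_basis_of_exists_lt ⟨0, hadm.rho_pos⟩).tendsto_right_iff]
  intro t ht
  obtain ⟨s, hs, hsρ⟩ := exists_between (max_lt ht hadm.rho_pos)
  have hs' : s ∈ Ioo 0 ρ := ⟨(le_max_right _ _).trans_lt hs, hsρ⟩
  have hpos := hadm.moment_pos ha hs' 1
  filter_upwards [eventually_gt_atTop (moment (thetaWeights θ s) 1)] with x hx
  refine ⟨?_, (hadm.saddle_mem ha hr (hpos.trans hx)).2⟩
  have := hadm.strictMonoOn_saddle ha hr hpos (hpos.trans hx) hx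
  rw [hadm.saddle_moment_one ha hr hs'] at this
  exact ((le_max_left _ _).trans_lt hs).trans this

lemma hasDerivAt_saddle {x : ℝ} (hx : 0 < x) :
    HasDerivAt r (r x / moment (thetaWeights θ (r x)) 2) x := by
  have hmem := hadm.saddle_mem ha hr hx
  have hcont : ContinuousAt r x := by
    refine (hadm.strictMonoOn_saddle ha hr).continuousAt_of_image_mem_nhds (Ioi_mem_nhds hx) ?_
    filter_upwards [isOpen_Ioo.mem_nhds hmem] with t ht
    exact ⟨_, hadm.moment_pos ha ht 1, hadm.saddle_moment_one ha hr ht⟩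
  have h := HasDerivAt.of_local_left_inverse hcont (hadm.hasDerivAt_moment hmem 1)
    (div_pos (hadm.moment_pos ha hmem 2) hmem.1).ne'
    (by filter_upwards [Ioi_mem_nhds hx] with y hy using hadm.moment_one_saddle ha hr hy)
  rwa [inv_div] at h

/-- The technical condition bounds the third moment. -/
lemma exists_moment_three_le (htech : TechCond r) :
    ∃ C > 0, ∀ᶠ t in 𝓝[<] ρ, moment (thetaWeights θ t) 1 * moment (thetaWeights θ t) 3 ≤
      C * moment (thetaWeights θ t) 2 ^ 2 := by
  obtain ⟨C, hC, x₀, h⟩ := htech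
  refine ⟨C + 1, by linarith, ?_⟩
  filter_upwards [hadm.eventually_mem_Ioo, (hadm.tendsto_moment_one ha).eventually_ge_atTop x₀,
    (hadm.tendsto_momentRatio ha).eventually_le_const one_pos] with t ht hx0 hl
  have hx := hadm.moment_pos ha ht 1
  have h2 := h _ hx0 2 le_rfl (by norm_num)
  set x := moment (thetaWeights θ t) 1 with hxdef
  have hrx : r x = t := hadm.saddle_moment_one ha hr ht
  have hM2 := hadm.moment_pos ha ht 2
  have hM3 := hadm.moment_pos ha ht 3
  set M := moment (thetaWeights θ t) with hM
  have hd1 : deriv r =ᶠ[𝓝 x] fun y => r y / moment (thetaWeights θ (r y)) 2 := by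
    filter_upwards [Ioi_mem_nhds hx] with y hy using (hadm.hasDerivAt_saddle ha hr hy).deriv
  have hd := hadm.hasDerivAt_saddle ha hr hx
  rw [hrx] at hd
  have hd2 : HasDerivAt (fun y => moment (thetaWeights θ (r y)) 2) (M 3 / t * (t / M 2)) x := by
    have h3 := hadm.hasDerivAt_moment ht 2
    rw [← hrx] at h3
    have := h3.comp x hd
    rwa [hrx] at this
  have hd3 := hd.fun_div hd2 (by rw [hrx]; exact hM2.ne')
  rw [hrx] at hd3
  have e2 : iteratedDeriv 2 r x = t / M 2 * (1 / M 2 - M 3 / M 2 ^ 2) := by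
    rw [iteratedDeriv_succ, iteratedDeriv_one, hd1.deriv_eq, hd3.deriv, ← hM]
    have := ht.1.ne'
    field_simp
  have e1 : iteratedDeriv (2 - 1) r x = t / M 2 := by
    rw [show 2 - 1 = 1 from rfl, iteratedDeriv_one, hd.deriv]
  have hp : 0 < t / M 2 := div_pos ht.1 hM2
  rw [e1, e2, abs_mul, abs_of_pos hp] at h2
  have h3 : t / M 2 * x * (|1 / M 2 - M 3 / M 2 ^ 2| * x) ≤ t / M 2 * x * C := by
    calc _ = t / M 2 * |1 / M 2 - M 3 / M 2 ^ 2| * x ^ 2 := by ring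
      _ ≤ _ := h2
      _ = _ := by norm_num; ring
  have h4 := le_of_mul_le_mul_left h3 (by positivity)
  have h5 : (M 3 / M 2 ^ 2 - 1 / M 2) * x ≤ C := by
    refine le_trans (mul_le_mul_of_nonneg_right ?_ hx.le) h4
    rw [abs_sub_comm]; exact le_abs_self _
  have h6 : (M 3 / M 2 ^ 2 - 1 / M 2) * x = x * M 3 / M 2 ^ 2 - momentRatio θ t := by
    rw [momentRatio, ← hM, ← hxdef]; ring
  rw [h6] at h5
  rw [← div_le_iff₀ (by positivity)]
  linarith

end IsLogAdmissible

/-- Chebyshev's association inequality for an exponential tilt. -/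
lemma mul_le_mul_of_hasSum_tilt {p : ℕ → ℝ} (hp : ∀ k, 0 ≤ p k) {q S0 S1 T0 T1 : ℝ} (hq : 1 ≤ q)
    (hS0 : 0 < S0) (h0 : HasSum p S0) (h1 : HasSum (fun k => k * p k) S1)
    (h2 : HasSum (fun k => p k * q ^ k) T0) (h3 : HasSum (fun k => k * (p k * q ^ k)) T1) :
    S1 * T0 ≤ T1 * S0 := by
  set N := S1 / S0 with hN
  have h := (h3.sub (h2.mul_left N)).sub ((h1.sub (h0.mul_left N)).mul_left (q ^ N))
  have h4 := h.nonneg fun k => by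
    have e : (k * (p k * q ^ k) - N * (p k * q ^ k)) - q ^ N * (k * p k - N * p k) =
        p k * ((k - N) * (q ^ (k : ℝ) - q ^ N)) := by
      rw [Real.rpow_natCast]; ring
    rw [e]
    refine mul_nonneg (hp k) ?_
    rcases le_total (k : ℝ) N with hk | hk
    · exact mul_nonneg_of_nonpos_of_nonpos (sub_nonpos.2 hk)
        (sub_nonpos.2 (Real.rpow_le_rpow_of_exponent_le hq hk))
    · exact mul_nonneg (sub_nonneg.2 hk)
        (sub_nonneg.2 (Real.rpow_le_rpow_of_exponent_le hq hk))
  have e1 : S1 - N * S0 = 0 := by rw [hN]; field_simp; ring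
  rw [e1, mul_zero, sub_zero, hN, sub_nonneg, div_mul_eq_mul_div, div_le_iff₀ hS0] at h4
  exact h4

namespace IsLogAdmissible

variable {θ : ℕ → ℝ} {ρ : ℝ} {a b δ : ℝ → ℝ}
  (hadm : IsLogAdmissible (gThetaC θ) (thetaCoeff θ) ρ a b δ)
  (ha : ∀ t ∈ Set.Ico (0 : ℝ) ρ, a t = t * deriv (gThetaR θ) t)
include hadm ha

lemma continuousOn_momentRatio : ContinuousOn (momentRatio θ) (Ioo 0 ρ) := fun _ ht =>
  ((hadm.hasDerivAt_moment ht 1).continuousAt.div (hadm.hasDerivAt_moment ht 2).continuousAt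
    (hadm.moment_pos ha ht 2).ne').continuousWithinAt

lemma exists_momentRatio_eq_half {t : ℝ} (ht : t ∈ Ioo 0 ρ) :
    ∃ t', t ≤ t' ∧ t' < ρ ∧ momentRatio θ t' = momentRatio θ t / 2 := by
  have hpos := hadm.momentRatio_pos ha ht
  obtain ⟨s, hs1, hs2⟩ := (((hadm.tendsto_momentRatio ha).eventually_le_const
    (half_pos hpos)).and (Ioo_mem_nhdsLT ht.2)).exists
  have hsub : Icc t s ⊆ Ioo 0 ρ := fun x hx => ⟨ht.1.trans_le hx.1, hx.2.trans_lt hs2.2⟩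
  obtain ⟨t', ht', h⟩ := intermediate_value_Icc' hs2.1.le
    ((hadm.continuousOn_momentRatio ha).mono hsub) ⟨hs1, half_le_self hpos.le⟩
  exact ⟨t', ht'.1, ht'.2.trans_lt hs2.2, h⟩

/-- The third absolute moment of the residual is at most of the order of the residual variance. -/
lemma exists_third_moment_le {C : ℝ}
    (hC : ∀ᶠ t in 𝓝[<] ρ, moment (thetaWeights θ t) 1 * moment (thetaWeights θ t) 3 ≤
      C * moment (thetaWeights θ t) 2 ^ 2) :
    ∀ᶠ t in 𝓝[<] ρ, momentRatio θ t * moment (thetaWeights θ t) 1 -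
        2 * momentRatio θ t ^ 2 * moment (thetaWeights θ t) 2 +
        momentRatio θ t ^ 3 * moment (thetaWeights θ t) 3 ≤ 8 * C * cycleVar θ t := by
  obtain ⟨t₀, ht₀, hC⟩ :=
    ((nhdsLT_basis_of_exists_lt ⟨0, hadm.rho_pos⟩).eventually_iff).1 hC
  filter_upwards [hadm.eventually_mem_Ioo, Ioo_mem_nhdsLT ht₀,
    (hadm.tendsto_cycleVar ha).eventually_gt_atTop 0] with t ht htt₀ hV
  obtain ⟨t', htt', ht'ρ, hhalf⟩ := hadm.exists_momentRatio_eq_half ha ht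
  have ht' : t' ∈ Ioo 0 ρ := ⟨ht.1.trans_le htt', ht'ρ⟩
  have hm := hadm.hasMoments ht
  have hm' := hadm.hasMoments ht'
  have hc := hC (show t' ∈ Ioo t₀ ρ from ⟨htt₀.1.trans_le htt', ht'ρ⟩)
  have hl := hadm.momentRatio_mul ha ht
  have hl' := hadm.momentRatio_mul ha ht'
  have hlpos := hadm.momentRatio_pos ha ht
  have hlpos' := hadm.momentRatio_pos ha ht'
  have hM1 := hadm.moment_pos ha ht' 1
  have hM2 := hadm.moment_pos ha ht' 2
  set l := momentRatio θ t
  set l' := momentRatio θ t'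
  have hll : l = 2 * l' := by linarith
  have hw : ∀ k, thetaWeights θ t' k = thetaWeights θ t k * (t' / t) ^ k := by
    intro k
    have := ht.1.ne'
    rw [thetaWeights, thetaWeights, div_pow]; field_simp
  have h0 := hm.hasSum_quadratic 0 1 (-2 * l) (l ^ 2)
  have h1 := hm.hasSum_quadratic 1 1 (-2 * l) (l ^ 2)
  have h2 := hm'.hasSum_quadratic 0 1 (-2 * l) (l ^ 2)
  have h3 := hm'.hasSum_quadratic 1 1 (-2 * l) (l ^ 2)
  simp only [zero_add, pow_zero, one_mul, Nat.reduceAdd, pow_one] at h0 h1 h2 h3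
  have hP : l' * moment (thetaWeights θ t') 1 ≤ moment (thetaWeights θ t') 0 := by
    have h := hm'.hasSum_quadratic 0 1 (-2 * l') (l' ^ 2)
    have h4 := h.nonneg fun k => by
      have := hm'.nonneg k
      have e : 1 + -2 * l' * k + l' ^ 2 * (k : ℝ) ^ 2 = (1 - l' * k) ^ 2 := by ring
      rw [e]; positivity
    simp only [zero_add] at h4
    have e : l' ^ 2 * moment (thetaWeights θ t') 2 = l' * moment (thetaWeights θ t') 1 := by
      rw [← hl']; ring
    linarith
  have hV0 : 1 * moment (thetaWeights θ t) 0 + -2 * l * moment (thetaWeights θ t) 1 +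
      l ^ 2 * moment (thetaWeights θ t) 2 = cycleVar θ t := by
    rw [cycleVar, ← hl]; ring
  rw [one_mul] at hV0
  rw [hV0] at h0
  have key := mul_le_mul_of_hasSum_tilt (q := t' / t)
    (p := fun k => (1 + -2 * l * k + l ^ 2 * (k : ℝ) ^ 2) * thetaWeights θ t k)
    (fun k => by
      have := hm.nonneg k
      have e : 1 + -2 * l * k + l ^ 2 * (k : ℝ) ^ 2 = (1 - l * k) ^ 2 := by ring
      simp only [e]; positivity) ((one_le_div ht.1).2 htt') hV h0
    (by simpa only [mul_assoc] using h1)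
    (by simpa only [mul_assoc, hw] using h2)
    (by simpa only [mul_assoc, hw] using h3)
  set M' := moment (thetaWeights θ t')
  set M := moment (thetaWeights θ t)
  have e2 : M' 0 + -2 * l * M' 1 + l ^ 2 * M' 2 = M' 0 := by
    rw [hll, ← hl']; ring
  simp only [← mul_assoc] at key
  rw [e2] at key
  have h5 : l' ^ 3 * M' 3 ≤ C * (l' * M' 1) := by
    have e : l' ^ 3 * M' 3 * M' 2 ^ 2 = l' * M' 1 * (M' 1 * M' 3) := by rw [← hl']; ring
    have : l' ^ 3 * M' 3 * M' 2 ^ 2 ≤ C * (l' * M' 1) * M' 2 ^ 2 := by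
      rw [e]
      calc _ ≤ l' * M' 1 * (C * M' 2 ^ 2) := by gcongr
        _ = _ := by ring
    exact le_of_mul_le_mul_right this (by positivity)
  have h6 : l * (M' 1 + -2 * l * M' 2 + l ^ 2 * M' 3) ≤ 8 * C * (l' * M' 1) := by
    have e : l * (M' 1 + -2 * l * M' 2 + l ^ 2 * M' 3) =
        -6 * (l' * M' 1) + 8 * (l' ^ 3 * M' 3) := by
      rw [hll, ← hl']; ring
    have : 0 < l' * M' 1 := by positivity
    rw [e]; linarith
  set S1 := M 1 + -2 * l * M 2 + l ^ 2 * M 3 with hS1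
  have hS1n : 0 ≤ S1 := h1.nonneg fun k => by
    have := hm.nonneg k
    have e : 1 + -2 * l * k + l ^ 2 * (k : ℝ) ^ 2 = (1 - l * k) ^ 2 := by ring
    rw [e]; positivity
  have h7 : (l' * M' 1) * (l * S1) ≤ (l' * M' 1) * (8 * C * cycleVar θ t) := by
    calc (l' * M' 1) * (l * S1) ≤ M' 0 * (l * S1) := by gcongr
      _ = l * (S1 * M' 0) := by ring
      _ ≤ l * ((M' 1 + -2 * l * M' 2 + l ^ 2 * M' 3) * cycleVar θ t) := by gcongr
      _ = l * (M' 1 + -2 * l * M' 2 + l ^ 2 * M' 3) * cycleVar θ t := by ring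
      _ ≤ 8 * C * (l' * M' 1) * cycleVar θ t := by gcongr
      _ = _ := by ring
  have h8 := le_of_mul_le_mul_left h7 (by positivity)
  refine le_trans (le_of_eq ?_) h8
  rw [hS1]; ring

end IsLogAdmissible

lemma HasMoments.continuous_charSum {m : ℕ → ℝ} (hm : HasMoments m) : Continuous (charSum m) := by
  refine continuous_tsum (u := m) (fun k => by fun_prop) hm.hasSum_zero.summable fun k φ => ?_
  simp only [norm_mul, Complex.norm_exp_ofReal_mul_I, Complex.norm_real, Real.norm_eq_abs,
    abs_of_nonneg (hm.nonneg _), mul_one, le_refl]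

/-- The logarithm of the Cauchy integrand on the circle of radius `t`, twisted by `exp (s * I)`,
in the rotated angle `ψ`, with its constant and linear parts removed. -/
def saddlePhase (θ : ℕ → ℝ) (t s ψ : ℝ) : ℂ :=
  Complex.exp (s * Complex.I) * charSum (thetaWeights θ t) (ψ - momentRatio θ t * s) -
    (moment (thetaWeights θ t) 0 + (s * moment (thetaWeights θ t) 0 +
      (ψ - momentRatio θ t * s) * moment (thetaWeights θ t) 1) * Complex.I)

namespace IsLogAdmissible

variable {θ : ℕ → ℝ} {ρ : ℝ} {a b δ : ℝ → ℝ}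
  (hadm : IsLogAdmissible (gThetaC θ) (thetaCoeff θ) ρ a b δ)
  (ha : ∀ t ∈ Set.Ico (0 : ℝ) ρ, a t = t * deriv (gThetaR θ) t)
include hadm

lemma continuous_saddlePhase {t : ℝ} (ht : t ∈ Ioo 0 ρ) (s : ℝ) :
    Continuous (saddlePhase θ t s) := by
  have := (hadm.hasMoments ht).continuous_charSum
  unfold saddlePhase
  fun_prop

include ha

lemma exists_major_arc_bound {C : ℝ}
    (hC : ∀ᶠ t in 𝓝[<] ρ, moment (thetaWeights θ t) 1 * moment (thetaWeights θ t) 3 ≤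
      C * moment (thetaWeights θ t) 2 ^ 2) (τ : ℝ) :
    ∃ E : ℝ → ℝ, Tendsto E (𝓝[<] ρ) (𝓝 0) ∧ ∀ᶠ t in 𝓝[<] ρ, ∀ ψ, |ψ| ≤ δ t →
      ‖saddlePhase θ t (τ / √(cycleVar θ t)) ψ +
        ((τ ^ 2 + ψ ^ 2 * moment (thetaWeights θ t) 2) / 2 : ℝ)‖ ≤ E t := by
  refine ⟨fun t => 4 / 6 * (|τ| ^ 3 * (1 + 8 * C) / √(cycleVar θ t)) +
    4 / 6 * (moment (thetaWeights θ t) 3 * δ t ^ 3), ?_, ?_⟩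
  · have h1 := (Real.tendsto_sqrt_atTop.comp (hadm.tendsto_cycleVar ha)).const_div_atTop
      (|τ| ^ 3 * (1 + 8 * C))
    have h2 := (h1.const_mul (4 / 6)).add ((hadm.tendsto_moment_three_mul ha).const_mul (4 / 6))
    simpa using h2
  · filter_upwards [hadm.eventually_mem_Ioo, hadm.exists_third_moment_le ha hC,
      (hadm.tendsto_cycleVar ha).eventually_gt_atTop 0] with t ht hT hV ψ hψ
    have hm := hadm.hasMoments ht
    have hl := hadm.momentRatio_pos ha ht
    have h := hm.norm_exp_mul_charSum_sub_quadratic_le (τ / √(cycleVar θ t)) ψ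
      (momentRatio θ t) (hadm.momentRatio_mul ha ht)
    have hW : √(cycleVar θ t) ^ 2 = cycleVar θ t := Real.sq_sqrt hV.le
    have hW0 : 0 < √(cycleVar θ t) := Real.sqrt_pos.2 hV
    rw [← cycleVar, abs_of_pos hl] at h
    set W := √(cycleVar θ t)
    have hWc : ((W : ℝ) : ℂ) ≠ 0 := Complex.ofReal_ne_zero.2 hW0.ne'
    have e : saddlePhase θ t (τ / W) ψ +
        ((τ ^ 2 + ψ ^ 2 * moment (thetaWeights θ t) 2) / 2 : ℝ) =
        Complex.exp ((τ / W : ℝ) * Complex.I) *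
          charSum (thetaWeights θ t) (ψ - momentRatio θ t * (τ / W)) -
        (moment (thetaWeights θ t) 0 + ((τ / W : ℝ) * moment (thetaWeights θ t) 0 +
          (ψ - momentRatio θ t * (τ / W : ℝ)) * moment (thetaWeights θ t) 1) * Complex.I -
          ((τ / W : ℝ) ^ 2 * cycleVar θ t + ψ ^ 2 * moment (thetaWeights θ t) 2) / 2) := by
      rw [saddlePhase, ← hW]
      push_cast
      field_simp
      ring
    rw [e]
    have hcv : ((cycleVar θ t : ℝ) : ℂ) = moment (thetaWeights θ t) 0 -
        momentRatio θ t * moment (thetaWeights θ t) 1 := by rw [cycleVar]; push_cast; ring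
    rw [hcv]
    refine h.trans (add_le_add ?_ ?_)
    · rw [mul_assoc]
      refine mul_le_mul_of_nonneg_left ?_ (by norm_num)
      calc |τ / W| ^ 3 * _ ≤ |τ / W| ^ 3 * ((1 + 8 * C) * W ^ 2) := by
            refine mul_le_mul_of_nonneg_left ?_ (by positivity)
            rw [hW]
            refine le_trans (le_of_eq ?_)
              (le_trans (add_le_add_right hT (cycleVar θ t)) (le_of_eq ?_)) <;> ring
        _ = _ := by
            rw [abs_div, abs_of_pos hW0]; field_simp
    · rw [mul_assoc, mul_comm (moment _ 3)]
      have := hm.moment_nonneg 3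
      gcongr

lemma exists_norm_exp_saddlePhase_le {C : ℝ}
    (hC : ∀ᶠ t in 𝓝[<] ρ, moment (thetaWeights θ t) 1 * moment (thetaWeights θ t) 3 ≤
      C * moment (thetaWeights θ t) 2 ^ 2) (τ : ℝ) :
    ∃ B : ℝ, ∀ᶠ t in 𝓝[<] ρ, ∀ ψ, |ψ| ≤ Real.pi →
      ‖Complex.exp (saddlePhase θ t (τ / √(cycleVar θ t)) ψ)‖ ≤
        B * (1 + ψ ^ 2 * moment (thetaWeights θ t) 2)⁻¹ := by
  obtain ⟨E, hE, hmaj⟩ := hadm.exists_major_arc_bound ha hC τ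
  obtain ⟨ε, hε, hmin⟩ := hadm.exists_minor_arc_bound ha
  refine ⟨max (2 * Real.exp 1) (Real.exp ((1 + τ ^ 2) / 2) * (1 + Real.pi ^ 2)), ?_⟩
  filter_upwards [hadm.eventually_mem_Ioo, hmaj, hE.eventually_le_const zero_lt_one,
    hε.eventually_le_const zero_lt_one, (hadm.tendsto_cycleVar ha).eventually_gt_atTop 0,
    (hadm.tendsto_moment_two ha).eventually_ge_atTop 1,
    (hadm.tendsto_width ha (ε := 1 / 4) (by norm_num)).eventually_ge_atTop 0]
    with t ht hmaj hE hε hV hM2 hw ψ hψ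
  have hm := hadm.hasMoments ht
  rw [Complex.norm_exp]
  have hpos : 0 < 1 + ψ ^ 2 * moment (thetaWeights θ t) 2 := by positivity
  set M2 := moment (thetaWeights θ t) 2
  rw [← div_eq_mul_inv, le_div_iff₀ hpos]
  rcases le_total |ψ| (δ t) with h | h
  · refine le_trans ?_ (le_max_left _ _)
    have h1 := (Complex.abs_re_le_norm _).trans (hmaj ψ h)
    rw [Complex.add_re, Complex.ofReal_re] at h1
    have h2 := (abs_le.1 h1).2
    have h3 : (saddlePhase θ t (τ / √(cycleVar θ t)) ψ).re ≤ 1 - ψ ^ 2 * M2 / 2 := by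
      nlinarith [sq_nonneg τ]
    calc _ ≤ Real.exp (1 - ψ ^ 2 * M2 / 2) * (2 * Real.exp (ψ ^ 2 * M2 / 2)) := by
          gcongr
          have := Real.add_one_le_exp (ψ ^ 2 * M2 / 2)
          linarith
      _ = _ := by
          rw [mul_left_comm, ← Real.exp_add]; ring_nf
  · refine le_trans ?_ (le_max_right _ _)
    have h1 := hmin t ht ψ h hψ
    have h2 := hm.half_sub_re_le (τ / √(cycleVar θ t)) ψ (momentRatio θ t)
      (hadm.momentRatio_mul ha ht)
    rw [← cycleVar, div_pow, Real.sq_sqrt hV.le] at h2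
    have h3 : τ ^ 2 / cycleVar θ t / 2 * cycleVar θ t = τ ^ 2 / 2 := by field_simp
    rw [h3] at h2
    have h4 : (saddlePhase θ t (τ / √(cycleVar θ t)) ψ).re =
        (Complex.exp ((τ / √(cycleVar θ t) : ℝ) * Complex.I) * charSum (thetaWeights θ t)
          (ψ - momentRatio θ t * (τ / √(cycleVar θ t)))).re - moment (thetaWeights θ t) 0 := by
      rw [saddlePhase, Complex.sub_re, Complex.add_re, Complex.ofReal_re]
      congr 1
      rw [add_eq_left]
      rw [← Complex.ofReal_mul, ← Complex.ofReal_mul, ← Complex.ofReal_sub, ← Complex.ofReal_mul,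
        ← Complex.ofReal_add, Complex.re_ofReal_mul, Complex.I_re, mul_zero]
    have h5 : (saddlePhase θ t (τ / √(cycleVar θ t)) ψ).re ≤
        (1 + τ ^ 2) / 2 - Real.log M2 := by
      rw [h4]; linarith
    have hψ2 : ψ ^ 2 ≤ Real.pi ^ 2 := sq_le_sq' (by linarith [(abs_le.1 hψ).1]) (abs_le.1 hψ).2
    calc _ ≤ Real.exp ((1 + τ ^ 2) / 2 - Real.log M2) * ((1 + Real.pi ^ 2) * M2) := by
          gcongr
          nlinarith
      _ = _ := by
          rw [Real.exp_sub, Real.exp_log (by linarith)]; field_simp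

theorem tendsto_sqrt_mul_integral {C : ℝ}
    (hC : ∀ᶠ t in 𝓝[<] ρ, moment (thetaWeights θ t) 1 * moment (thetaWeights θ t) 3 ≤
      C * moment (thetaWeights θ t) 2 ^ 2) (τ : ℝ) :
    Tendsto (fun t => (√(moment (thetaWeights θ t) 2) : ℂ) * ∫ ψ in (-Real.pi)..Real.pi,
      Complex.exp (saddlePhase θ t (τ / √(cycleVar θ t)) ψ)) (𝓝[<] ρ)
      (𝓝 (Real.exp (-τ ^ 2 / 2) * √(2 * Real.pi) : ℝ)) := by
  obtain ⟨E, hE, hmaj⟩ := hadm.exists_major_arc_bound ha hC τ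
  obtain ⟨B, hB⟩ := hadm.exists_norm_exp_saddlePhase_le ha hC τ
  have hlim : ∫ v : ℝ, Complex.exp ((-(τ ^ 2 + v ^ 2) / 2 : ℝ)) =
      (Real.exp (-τ ^ 2 / 2) * √(2 * Real.pi) : ℝ) := by
    have h1 := integral_gaussian (1 / 2)
    rw [show Real.pi / (1 / 2) = 2 * Real.pi by ring] at h1
    rw [← h1, ← integral_const_mul, ← integral_complex_ofReal]
    refine integral_congr_ae (Eventually.of_forall fun v => ?_)
    simp only
    rw [← Complex.ofReal_exp, ← Real.exp_add]
    ring_nf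
  rw [← hlim]
  set F : ℝ → ℝ → ℂ := fun t v => (Ioc (-Real.pi * √(moment (thetaWeights θ t) 2))
    (Real.pi * √(moment (thetaWeights θ t) 2))).indicator (fun v =>
      Complex.exp (saddlePhase θ t (τ / √(cycleVar θ t))
        (v / √(moment (thetaWeights θ t) 2)))) v with hF
  have hsq : ∀ᶠ t in 𝓝[<] ρ, 0 < √(moment (thetaWeights θ t) 2) := by
    filter_upwards [hadm.eventually_mem_Ioo] with t ht
    exact Real.sqrt_pos.2 (hadm.moment_pos ha ht 2)
  have hFint : ∀ᶠ t in 𝓝[<] ρ, ∫ v, F t v = (√(moment (thetaWeights θ t) 2) : ℂ) *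
      ∫ ψ in (-Real.pi)..Real.pi, Complex.exp (saddlePhase θ t (τ / √(cycleVar θ t)) ψ) := by
    filter_upwards [hsq] with t ht
    simp only [hF]
    rw [integral_indicator measurableSet_Ioc, ← intervalIntegral.integral_of_le (by
      nlinarith [Real.pi_pos])]
    rw [intervalIntegral.integral_comp_div (fun x => Complex.exp (saddlePhase θ t
      (τ / √(cycleVar θ t)) x)) ht.ne', mul_div_cancel_right₀ _ ht.ne',
      mul_div_cancel_right₀ _ ht.ne', Complex.real_smul]
  refine Tendsto.congr' hFint ?_
  refine tendsto_integral_filter_of_dominated_convergence (fun v => B * (1 + v ^ 2)⁻¹) ?_ ?_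
    (integrable_inv_one_add_sq.const_mul B) (Eventually.of_forall fun v => ?_)
  · filter_upwards [hadm.eventually_mem_Ioo] with t ht
    refine AEStronglyMeasurable.indicator ?_ measurableSet_Ioc
    have := hadm.continuous_saddlePhase ht (τ / √(cycleVar θ t))
    exact (by fun_prop : Continuous fun v : ℝ => Complex.exp (saddlePhase θ t
      (τ / √(cycleVar θ t)) (v / √(moment (thetaWeights θ t) 2)))).aestronglyMeasurable
  · filter_upwards [hB, hsq] with t hB ht
    refine Eventually.of_forall fun v => ?_
    have hp : (√(moment (thetaWeights θ t) 2)) ^ 2 = moment (thetaWeights θ t) 2 :=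
      Real.sq_sqrt (Real.sqrt_pos.1 ht).le
    simp only [hF]
    by_cases hv : v ∈ Ioc (-Real.pi * √(moment (thetaWeights θ t) 2))
      (Real.pi * √(moment (thetaWeights θ t) 2))
    · rw [indicator_of_mem hv]
      refine (hB _ ?_).trans (le_of_eq ?_)
      · rw [abs_le, le_div_iff₀ ht, div_le_iff₀ ht]
        exact ⟨hv.1.le, hv.2⟩
      · rw [← hp, div_pow, Real.sqrt_sq ht.le, div_mul_cancel₀ _ (pow_pos ht 2).ne']
    · rw [indicator_of_notMem hv, norm_zero]
      have h0 := (norm_nonneg _).trans (hB 0 (by simpa using Real.pi_pos.le))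
      simp only [ne_eq, OfNat.ofNat_ne_zero, not_false_eq_true, zero_pow, zero_mul, add_zero,
        inv_one, mul_one] at h0
      positivity
  · have hv1 : ∀ᶠ t in 𝓝[<] ρ, |v / √(moment (thetaWeights θ t) 2)| ≤ δ t := by
      filter_upwards [hadm.eventually_mem_Ioo, hsq,
        (hadm.tendsto_delta_sq_mul ha).eventually_ge_atTop (v ^ 2)] with t ht hs h
      have hd := hadm.delta_pos t ⟨ht.1.le, ht.2⟩
      refine abs_le_of_sq_le_sq ?_ hd.le
      rw [div_pow, Real.sq_sqrt (Real.sqrt_pos.1 hs).le, div_le_iff₀ (Real.sqrt_pos.1 hs)]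
      exact h
    have hphase : Tendsto (fun t => saddlePhase θ t (τ / √(cycleVar θ t))
        (v / √(moment (thetaWeights θ t) 2))) (𝓝[<] ρ) (𝓝 ((-(τ ^ 2 + v ^ 2) / 2 : ℝ) : ℂ)) := by
      rw [tendsto_iff_norm_sub_tendsto_zero]
      refine squeeze_zero' (Eventually.of_forall fun t => norm_nonneg _) ?_ hE
      filter_upwards [hmaj, hv1, hsq] with t h1 h2 hs
      refine le_trans (le_of_eq ?_) (h1 _ h2)
      rw [div_pow, Real.sq_sqrt (Real.sqrt_pos.1 hs).le,
        div_mul_cancel₀ _ (Real.sqrt_pos.1 hs).ne', sub_eq_add_neg, ← Complex.ofReal_neg]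
      ring_nf
    have hbig : Tendsto (fun t => Real.pi * √(moment (thetaWeights θ t) 2)) (𝓝[<] ρ) atTop :=
      (Real.tendsto_sqrt_atTop.comp (hadm.tendsto_moment_two ha)).const_mul_atTop Real.pi_pos
    refine Tendsto.congr' ?_ ((Complex.continuous_exp.tendsto _).comp hphase)
    filter_upwards [hbig.eventually_gt_atTop |v|] with t h
    simp only [hF]
    rw [indicator_of_mem]
    · rfl
    · rw [neg_mul]
      exact ⟨(abs_lt.1 h).1, (abs_lt.1 h).2.le⟩

end IsLogAdmissible

lemma periodic_charSum (m : ℕ → ℝ) : Function.Periodic (charSum m) (2 * Real.pi) := fun φ => by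
  refine tsum_congr fun k => ?_
  congr 1
  rw [Complex.exp_eq_exp_iff_exists_int]
  exact ⟨k, by push_cast; ring⟩

namespace IsLogAdmissible

variable {θ : ℕ → ℝ} {ρ : ℝ} {a b δ : ℝ → ℝ}
  (hadm : IsLogAdmissible (gThetaC θ) (thetaCoeff θ) ρ a b δ)
include hadm

lemma mul_sum_exp_numCycles {t : ℝ} (ht : t ∈ Ioo 0 ρ) {n : ℕ}
    (hn : moment (thetaWeights θ t) 1 = n) (s : ℝ) :
    (2 * Real.pi * t ^ n : ℂ) * ∑ σ : Equiv.Perm (Fin n),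
        Complex.exp (s * numCycles n σ * Complex.I) * (ewensWeight θ n σ : ℂ) =
      n.factorial * Complex.exp (moment (thetaWeights θ t) 0) *
        Complex.exp (s * moment (thetaWeights θ t) 0 * Complex.I) *
        ∫ ψ in (-Real.pi)..Real.pi, Complex.exp (saddlePhase θ t s ψ) := by
  have h1 := sum_pow_numCycles_mul_ewensWeight θ n (Complex.exp (s * Complex.I))
  rw [← iteratedDeriv_exp_mul_gThetaC hadm.series hadm.rho_pos _ le_rfl] at h1
  have h2 := intervalIntegral_exp_neg_mul_eq_iteratedDeriv ht.1 ht.2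
    (F := fun z => Complex.exp (Complex.exp (s * Complex.I) * gThetaC θ z))
    ((differentiableOn_gThetaC hadm.series).const_mul _).cexp n
  rw [← h1] at h2
  have h3 : ∑ σ : Equiv.Perm (Fin n), Complex.exp (s * numCycles n σ * Complex.I) *
      (ewensWeight θ n σ : ℂ) = ∑ σ : Equiv.Perm (Fin n),
        Complex.exp (s * Complex.I) ^ numCycles n σ * (ewensWeight θ n σ : ℂ) := by
    refine Finset.sum_congr rfl fun σ _ => ?_
    rw [← Complex.exp_nat_mul]
    ring_nf
  rw [h3]
  simp only [gThetaC_mul_exp] at h2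
  set G : ℝ → ℂ := fun φ => Complex.exp (Complex.exp (s * Complex.I) *
    charSum (thetaWeights θ t) φ) * Complex.exp (-(n * φ * Complex.I)) with hG
  have hper : Function.Periodic G (2 * Real.pi) := fun φ => by
    simp only [hG]
    rw [periodic_charSum]
    congr 1
    rw [Complex.exp_eq_exp_iff_exists_int]
    exact ⟨-n, by push_cast; ring⟩
  have hshift : ∫ ψ in (-Real.pi)..Real.pi, G (ψ - momentRatio θ t * s) =
      ∫ φ in (-Real.pi)..Real.pi, G φ := by
    rw [intervalIntegral.integral_comp_sub_right G]
    have := hper.intervalIntegral_add_eq (-Real.pi - momentRatio θ t * s) (-Real.pi)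
    convert! this using 2 <;> ring
  have hfac : ((n.factorial : ℕ) : ℂ) ≠ 0 := Nat.cast_ne_zero.2 n.factorial_ne_zero
  have h4 : ∫ φ in (-Real.pi)..Real.pi, G φ = Complex.exp (moment (thetaWeights θ t) 0) *
        Complex.exp (s * moment (thetaWeights θ t) 0 * Complex.I) *
        ∫ ψ in (-Real.pi)..Real.pi, Complex.exp (saddlePhase θ t s ψ) := by
    rw [← hshift, ← intervalIntegral.integral_const_mul]
    refine intervalIntegral.integral_congr fun ψ _ => ?_
    simp only [hG]
    rw [← Complex.exp_add, ← Complex.exp_add, ← Complex.exp_add, saddlePhase, hn]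
    push_cast
    ring_nf
  rw [mul_assoc (n.factorial * _ : ℂ), mul_assoc (n.factorial : ℂ), ← mul_assoc (Complex.exp _),
    ← h4, h2]
  field_simp

end IsLogAdmissible

lemma gaussianReal_Iic (x : ℝ) :
    (ProbabilityTheory.gaussianReal 0 1 (Iic x)).toReal = stdNormalCDF x := by
  rw [ProbabilityTheory.gaussianReal_apply_eq_integral 0 one_ne_zero,
    ENNReal.toReal_ofReal (integral_nonneg fun y => ProbabilityTheory.gaussianPDFReal_nonneg _ _ y),
    stdNormalCDF]
  refine integral_congr_ae (Eventually.of_forall fun y => ?_)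
  simp [ProbabilityTheory.gaussianPDFReal, div_eq_inv_mul]

/-- The law of a real statistic under weights `w`, or a point mass if the weights sum to zero. -/
def weightedLaw {ι : Type*} [Fintype ι] (w X : ι → ℝ) : Measure ℝ :=
  open scoped Classical in
  if 0 < ∑ i, w i then ∑ i, ENNReal.ofReal (w i / ∑ j, w j) • Measure.dirac (X i)
  else Measure.dirac 0

section WeightedLaw

variable {ι : Type*} [Fintype ι] {w X : ι → ℝ}

lemma isProbabilityMeasure_weightedLaw (hw : ∀ i, 0 ≤ w i) :
    IsProbabilityMeasure (weightedLaw w X) := by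
  rw [weightedLaw]
  split_ifs with h
  · refine ⟨?_⟩
    simp only [Measure.coe_finsetSum, Finset.sum_apply, Measure.smul_apply, measure_univ,
      smul_eq_mul, mul_one]
    rw [← ENNReal.ofReal_sum_of_nonneg fun i _ => div_nonneg (hw i) h.le, ← Finset.sum_div,
      div_self h.ne', ENNReal.ofReal_one]
  · infer_instance

lemma charFun_weightedLaw (hw : ∀ i, 0 ≤ w i) (h : 0 < ∑ i, w i) (τ : ℝ) :
    charFun (weightedLaw w X) τ =
      (∑ i, Complex.exp (τ * X i * Complex.I) * (w i : ℂ)) / ((∑ i, w i : ℝ) : ℂ) := by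
  rw [weightedLaw, if_pos h, charFun_apply_real, integral_finsetSum_measure, Finset.sum_div]
  · refine Finset.sum_congr rfl fun i _ => ?_
    rw [integral_smul_measure, integral_dirac, ENNReal.toReal_ofReal (div_nonneg (hw i) h.le),
      Complex.real_smul]
    push_cast
    ring
  · intro i _
    exact (integrable_dirac (by simp)).smul_measure ENNReal.ofReal_ne_top

open scoped Classical in
lemma weightedLaw_Iic (hw : ∀ i, 0 ≤ w i) (h : 0 < ∑ i, w i) (x : ℝ) :
    (weightedLaw w X (Iic x)).toReal =
      (∑ i ∈ Finset.univ.filter fun i => X i ≤ x, w i) / ∑ i, w i := by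
  rw [weightedLaw, if_pos h]
  simp only [Measure.coe_finsetSum, Finset.sum_apply, Measure.smul_apply, smul_eq_mul,
    Measure.dirac_apply' _ measurableSet_Iic]
  rw [ENNReal.toReal_sum fun i _ => ENNReal.mul_ne_top ENNReal.ofReal_ne_top
    (by by_cases hi : X i ≤ x <;> simp [hi]), Finset.sum_filter, Finset.sum_div]
  refine Finset.sum_congr rfl fun i _ => ?_
  by_cases hi : X i ≤ x <;> simp [hi, div_nonneg (hw i) h.le]

end WeightedLaw

/-- Lévy's criterion for weighted statistics on a sequence of finite types. -/
theorem tendsto_weighted_cdf {ι : ℕ → Type*} [∀ n, Fintype (ι n)] {w X : ∀ n, ι n → ℝ}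
    (hw : ∀ n i, 0 ≤ w n i) (hpos : ∀ᶠ n in atTop, 0 < ∑ i, w n i)
    (h : ∀ τ : ℝ, Tendsto (fun n => (∑ i, Complex.exp (τ * X n i * Complex.I) * (w n i : ℂ)) /
      ((∑ i, w n i : ℝ) : ℂ)) atTop (𝓝 (Real.exp (-τ ^ 2 / 2) : ℝ))) (x : ℝ) :
    Tendsto (fun n => (weightedLaw (w n) (X n) (Iic x)).toReal) atTop (𝓝 (stdNormalCDF x)) := by
  let P : ℕ → ProbabilityMeasure ℝ := fun n =>
    ⟨weightedLaw (w n) (X n), isProbabilityMeasure_weightedLaw (hw n)⟩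
  let P₀ : ProbabilityMeasure ℝ := ⟨ProbabilityTheory.gaussianReal 0 1, inferInstance⟩
  have hlim : Tendsto P atTop (𝓝 P₀) := by
    refine ProbabilityMeasure.tendsto_of_tendsto_charFun fun τ => ?_
    have e : charFun (P₀ : Measure ℝ) τ = (Real.exp (-τ ^ 2 / 2) : ℝ) := by
      change charFun (ProbabilityTheory.gaussianReal 0 1) τ = _
      rw [ProbabilityTheory.charFun_gaussianReal]
      push_cast
      congr 1
      simp
      ring
    rw [e]
    refine (h τ).congr' ?_
    filter_upwards [hpos] with n hn
    exact (charFun_weightedLaw (hw n) hn τ).symm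
  have hfr : (P₀ : Measure ℝ) (frontier (Iic x)) = 0 := by
    rw [frontier_Iic]
    change ProbabilityTheory.gaussianReal 0 1 {x} = 0
    have := ProbabilityTheory.nullSingletonClass_gaussianReal (μ := 0) (v := 1) one_ne_zero
    exact measure_singleton x
  have h2 := ProbabilityMeasure.tendsto_measure_of_null_frontier_of_tendsto' hlim hfr
  rw [← gaussianReal_Iic x]
  exact (ENNReal.tendsto_toReal (measure_ne_top _ _)).comp h2

lemma ewensWeight_nonneg {θ : ℕ → ℝ} (hθ : ∀ j, 0 ≤ θ j) (n : ℕ) (σ : Equiv.Perm (Fin n)) :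
    0 ≤ ewensWeight θ n σ :=
  Finset.prod_nonneg fun j _ => pow_nonneg (hθ j) _

namespace IsLogAdmissible

variable {θ : ℕ → ℝ} {ρ : ℝ} {a b δ : ℝ → ℝ}
  (hadm : IsLogAdmissible (gThetaC θ) (thetaCoeff θ) ρ a b δ)
  (ha : ∀ t ∈ Set.Ico (0 : ℝ) ρ, a t = t * deriv (gThetaR θ) t)
  {r : ℝ → ℝ} (hr : ∀ x > 0, r x ∈ Set.Ico 0 ρ ∧ a (r x) = x)
include hadm ha hr

theorem convergesToStdNormal_of_techCond (hθ : ∀ j, 0 ≤ θ j) (htech : TechCond r) :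
    convergesToStdNormal θ (fun n => gThetaR θ (r n)) fun n => √(cycleVar θ (r n)) := by
  obtain ⟨C, -, hC⟩ := hadm.exists_moment_three_le ha hr htech
  have hrn : Tendsto (fun n : ℕ => r n) atTop (𝓝[<] ρ) :=
    (hadm.tendsto_saddle ha hr).comp tendsto_natCast_atTop_atTop
  have hJ := fun τ => (hadm.tendsto_sqrt_mul_integral ha hC τ).comp hrn
  have hJ0 := hJ 0
  simp only [zero_div, Function.comp_def, ne_eq, OfNat.ofNat_ne_zero, not_false_eq_true, zero_pow,
    neg_zero, Real.exp_zero, one_mul] at hJ0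
  have hpi : (√(2 * Real.pi) : ℂ) ≠ 0 :=
    Complex.ofReal_ne_zero.2 (Real.sqrt_pos.2 (by positivity)).ne'
  have hne := hJ0.eventually_ne hpi
  have hV := ((hadm.tendsto_cycleVar ha).comp hrn).eventually_gt_atTop 0
  have hbase : ∀ᶠ n : ℕ in atTop, r n ∈ Ioo 0 ρ ∧ moment (thetaWeights θ (r n)) 1 = n := by
    filter_upwards [eventually_gt_atTop 0] with n hn
    have hn' : (0 : ℝ) < n := Nat.cast_pos.2 hn
    exact ⟨hadm.saddle_mem ha hr hn', hadm.moment_one_saddle ha hr hn'⟩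
  have hsum0 : ∀ᶠ n : ℕ in atTop, (2 * Real.pi * r n ^ n : ℂ) *
      ((∑ σ : Equiv.Perm (Fin n), ewensWeight θ n σ : ℝ) : ℂ) =
        n.factorial * Complex.exp (moment (thetaWeights θ (r n)) 0) *
          ∫ ψ in (-Real.pi)..Real.pi, Complex.exp (saddlePhase θ (r n) 0 ψ) := by
    filter_upwards [hbase] with n hn
    have := hadm.mul_sum_exp_numCycles hn.1 hn.2 0
    simpa using this
  have hpos : ∀ᶠ n : ℕ in atTop, 0 < ∑ σ : Equiv.Perm (Fin n), ewensWeight θ n σ := by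
    filter_upwards [hsum0, hne] with n h1 h2
    refine lt_of_le_of_ne (Finset.sum_nonneg fun σ _ => ewensWeight_nonneg hθ n σ) fun h => ?_
    rw [← h, Complex.ofReal_zero, mul_zero, eq_comm] at h1
    exact mul_ne_zero (mul_ne_zero (Nat.cast_ne_zero.2 n.factorial_ne_zero)
      (Complex.exp_ne_zero _)) (right_ne_zero_of_mul h2) h1
  intro x
  refine (tendsto_weighted_cdf (w := fun n σ => ewensWeight θ n σ)
    (X := fun n σ => ((numCycles n σ : ℝ) - gThetaR θ (r n)) / √(cycleVar θ (r n)))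
    (fun n σ => ewensWeight_nonneg hθ n σ) hpos (fun τ => ?_) x).congr' ?_
  · have hquot := (hJ τ).div hJ0 hpi
    rw [Complex.ofReal_mul, mul_div_cancel_right₀ _ hpi] at hquot
    refine hquot.congr' ?_
    filter_upwards [hbase, hsum0, hpos, hne] with n hn h0 hp hJn
    have h1 := hadm.mul_sum_exp_numCycles hn.1 hn.2 (τ / √(cycleVar θ (r n)))
    have hM2 := left_ne_zero_of_mul hJn
    have hJ0n := right_ne_zero_of_mul hJn
    simp only [Function.comp_def, Pi.div_apply]
    set s := τ / √(cycleVar θ (r n)) with hs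
    set J := ∫ ψ in (-Real.pi)..Real.pi, Complex.exp (saddlePhase θ (r n) s ψ)
    set J₀ := ∫ ψ in (-Real.pi)..Real.pi, Complex.exp (saddlePhase θ (r n) 0 ψ)
    have hX : ∑ σ : Equiv.Perm (Fin n), Complex.exp (τ * ((((numCycles n σ : ℝ) -
        gThetaR θ (r n)) / √(cycleVar θ (r n)) : ℝ) : ℂ) * Complex.I) * (ewensWeight θ n σ : ℂ) =
        Complex.exp (-(s * moment (thetaWeights θ (r n)) 0 * Complex.I)) *
          ∑ σ : Equiv.Perm (Fin n),
            Complex.exp (s * numCycles n σ * Complex.I) * (ewensWeight θ n σ : ℂ) := by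
      rw [Finset.mul_sum]
      refine Finset.sum_congr rfl fun σ _ => ?_
      rw [← mul_assoc, ← Complex.exp_add, hs, moment_thetaWeights_zero]
      push_cast
      ring_nf
    have hW : ((∑ σ : Equiv.Perm (Fin n), ewensWeight θ n σ : ℝ) : ℂ) ≠ 0 :=
      Complex.ofReal_ne_zero.2 hp.ne'
    have hP : (2 * Real.pi * r n ^ n : ℂ) ≠ 0 := by
      have h2 : ((r n : ℝ) : ℂ) ≠ 0 := Complex.ofReal_ne_zero.2 hn.1.1.ne'
      have h3 : (Real.pi : ℂ) ≠ 0 := Complex.ofReal_ne_zero.2 Real.pi_ne_zero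
      exact mul_ne_zero (mul_ne_zero two_ne_zero h3) (pow_ne_zero n h2)
    rw [hX, mul_div_mul_left _ _ hM2, div_eq_div_iff hJ0n hW]
    refine mul_left_cancel₀ hP ?_
    have hexp : Complex.exp (-(s * moment (thetaWeights θ (r n)) 0 * Complex.I)) *
        Complex.exp (s * moment (thetaWeights θ (r n)) 0 * Complex.I) = 1 := by
      rw [← Complex.exp_add, neg_add_cancel, Complex.exp_zero]
    linear_combination J * h0 -
      Complex.exp (-(s * moment (thetaWeights θ (r n)) 0 * Complex.I)) * J₀ * h1 -
      n.factorial * Complex.exp (moment (thetaWeights θ (r n)) 0) * J * J₀ * hexp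
  · filter_upwards [hpos] with n hp
    rw [weightedLaw_Iic (fun σ => ewensWeight_nonneg hθ n σ) hp, ewensProb]

end IsLogAdmissible

/-- **Corollary 3.5.** Let `θ` define a generalized Ewens measure with `g_θ`
log-admissible and `r_x` (the unique solution of `a(r) = x`) satisfying the
technical condition (*). Then there are sequences `μ_n = g_θ(r_n)(1+o(1))` and
`σ_n² = (g_θ(r_n) + n η₁(n))(1+o(1))`, with `η₁(x) = -x r_x'/r_x`, such that
`(K_{0n} - μ_n)/σ_n` converges in distribution to a standard normal. -/
theorem clt_with_parameters
    (θ : ℕ → ℝ) (hθ : ∀ j, 0 ≤ θ j) (ρ : ℝ) (a b δ : ℝ → ℝ)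
    (hadm : IsLogAdmissible (gThetaC θ) (thetaCoeff θ) ρ a b δ)
    (ha : ∀ t ∈ Set.Ico (0 : ℝ) ρ, a t = t * deriv (gThetaR θ) t)
    (r : ℝ → ℝ) (hr : ∀ x > 0, r x ∈ Set.Ico 0 ρ ∧ a (r x) = x)
    (hru : ∀ x > 0, ∀ y ∈ Set.Ico (0 : ℝ) ρ, a y = x → y = r x)
    (htech : TechCond r) :
    ∃ μ σ' : ℕ → ℝ,
      μ ~[atTop] (fun n : ℕ => gThetaR θ (r n)) ∧
      (fun n => σ' n ^ 2) ~[atTop]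
        (fun n : ℕ => gThetaR θ (r n) + (n : ℝ) * (-(n : ℝ) * deriv r n / r n)) ∧
      convergesToStdNormal θ μ σ' := by
  refine ⟨fun n => gThetaR θ (r n), fun n => √(cycleVar θ (r n)), IsEquivalent.refl, ?_,
    hadm.convergesToStdNormal_of_techCond ha hr hθ htech⟩
  refine EventuallyEq.isEquivalent ?_
  have hrn : Tendsto (fun n : ℕ => r n) atTop (𝓝[<] ρ) :=
    (hadm.tendsto_saddle ha hr).comp tendsto_natCast_atTop_atTop
  filter_upwards [((hadm.tendsto_cycleVar ha).comp hrn).eventually_gt_atTop 0,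
    eventually_gt_atTop 0] with n hV hn
  have hn' : (0 : ℝ) < n := Nat.cast_pos.2 hn
  have hmem := hadm.saddle_mem ha hr hn'
  have hr0 := hmem.1.ne'
  have hM2 := (hadm.moment_pos ha hmem 2).ne'
  have hV' : 0 < cycleVar θ (r n) := hV
  rw [Real.sq_sqrt hV'.le, (hadm.hasDerivAt_saddle ha hr hn').deriv, cycleVar, momentRatio,
    hadm.moment_one_saddle ha hr hn', moment_thetaWeights_zero]
  field_simp
  ring
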